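/- arXiv:1403.4695 — 4 statements merged into one kernel-verified Lean document; each statement's English description precedes it below -/
import Mathlib

section
/- Assume the coexistence condition g² < g₁g₂. Fix any λ₁ > 0 and λ₂ > 0. Then the coupled Gross–Pitaevskii system with these coefficients has at most one positive solution: if (η₁,η₂) and (u₁,u₂) are both positive solutions of the system (with the same λ₁, λ₂), then u₁ ≡ η₁ and u₂ ≡ η₂ on ℝ². In particular any positive solution is radially symmetric. -/
open MeasureTheory Filter
open scoped Real Topology

noncomputable section

abbrev Pt := EuclideanSpace ℝ (Fin 2)

/-- The Laplacian, written as the sum of second directional derivatives along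
the coordinate axes. -/
def lapR (f : Pt → ℝ) (x : Pt) : ℝ :=
  ∑ i : Fin 2, iteratedDeriv 2 (fun t : ℝ => f (x + t • EuclideanSpace.single i (1:ℝ))) 0

/-- `(η₁, η₂)` solves the coupled Gross–Pitaevskii system with coefficients
`lam₁, lam₂`, including the decay at infinity. -/
def GPSolution (g₁ g₂ g ε lam₁ lam₂ : ℝ) (η₁ η₂ : Pt → ℝ) : Prop :=
  ContDiff ℝ (⊤ : ℕ∞) η₁ ∧ ContDiff ℝ (⊤ : ℕ∞) η₂ ∧
  (∀ x : Pt, -ε ^ 2 * lapR η₁ x + ‖x‖ ^ 2 * η₁ x + g₁ * η₁ x ^ 3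
      + g * η₁ x * η₂ x ^ 2 = lam₁ * η₁ x) ∧
  (∀ x : Pt, -ε ^ 2 * lapR η₂ x + ‖x‖ ^ 2 * η₂ x + g₂ * η₂ x ^ 3
      + g * η₁ x ^ 2 * η₂ x = lam₂ * η₂ x) ∧
  Tendsto η₁ (cocompact Pt) (𝓝 0) ∧ Tendsto η₂ (cocompact Pt) (𝓝 0)

/-- A positive solution of the coupled Gross–Pitaevskii system. -/
def GPPositiveSolution (g₁ g₂ g ε lam₁ lam₂ : ℝ) (η₁ η₂ : Pt → ℝ) : Prop :=
  GPSolution g₁ g₂ g ε lam₁ lam₂ η₁ η₂ ∧ (∀ x, 0 < η₁ x) ∧ (∀ x, 0 < η₂ x)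


/-- Directional derivative. -/
def pd (v : Pt) (f : Pt → ℝ) (x : Pt) : ℝ := fderiv ℝ f x v

lemma pd_contDiff (v : Pt) {f : Pt → ℝ} (hf : ContDiff ℝ (⊤ : ℕ∞) f) :
    ContDiff ℝ (⊤ : ℕ∞) (pd v f) := by
  have h : ContDiff ℝ (⊤ : ℕ∞) (fderiv ℝ f) := hf.fderiv_right (by simp)
  exact h.clm_apply contDiff_const

lemma smooth_diff {f : Pt → ℝ} (hf : ContDiff ℝ (⊤ : ℕ∞) f) : Differentiable ℝ f :=
  hf.differentiable (by simp)

lemma hasDerivAt_line (v : Pt) {f : Pt → ℝ} (hf : Differentiable ℝ f) (x : Pt) (t : ℝ) :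
    HasDerivAt (fun t : ℝ => f (x + t • v)) (pd v f (x + t • v)) t := by
  have h1 : HasDerivAt (fun t : ℝ => x + t • v) v t := by
    simpa using ((hasDerivAt_id t).smul_const v).const_add x
  exact (hf (x + t • v)).hasFDerivAt.comp_hasDerivAt t h1

lemma pd_eq (v : Pt) {f : Pt → ℝ} (hf : Differentiable ℝ f) {x : Pt} {c : ℝ}
    (h : HasDerivAt (fun t : ℝ => f (x + t • v)) c 0) : pd v f x = c := by
  have := hasDerivAt_line v hf x 0
  simpa using this.unique h

lemma hasDerivAt_line0 (v : Pt) {f : Pt → ℝ} (hf : Differentiable ℝ f) (x : Pt) :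
    HasDerivAt (fun t : ℝ => f (x + t • v)) (pd v f x) 0 := by
  simpa using hasDerivAt_line v hf x 0

lemma lapR_eq {f : Pt → ℝ} (hf : ContDiff ℝ (⊤ : ℕ∞) f) (x : Pt) :
    lapR f x = ∑ i : Fin 2, pd (EuclideanSpace.single i (1:ℝ)) (pd (EuclideanSpace.single i (1:ℝ)) f) x := by
  unfold lapR
  refine Finset.sum_congr rfl fun i _ => ?_
  set v : Pt := EuclideanSpace.single i (1:ℝ)
  rw [iteratedDeriv_succ, iteratedDeriv_one]
  have : deriv (fun t : ℝ => f (x + t • v)) = fun t => pd v f (x + t • v) := by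
    ext t; exact (hasDerivAt_line v (smooth_diff hf) x t).deriv
  rw [this, (hasDerivAt_line0 v (smooth_diff (pd_contDiff v hf)) x).deriv]

lemma lapR_isometry {f : Pt → ℝ} (hf : ContDiff ℝ (⊤ : ℕ∞) f) (T : Pt ≃ₗᵢ[ℝ] Pt) (x : Pt) :
    lapR (fun y => f (T y)) x = lapR f (T x) := by
  have key : ∀ (b : OrthonormalBasis (Fin 2) ℝ Pt) (y : Pt),
      (Laplacian.laplacian f) y = ∑ i, pd (b i) (pd (b i) f) y := by
    intro b y
    rw [InnerProductSpace.laplacian_eq_iteratedFDeriv_orthonormalBasis f b]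
    refine Finset.sum_congr rfl fun i _ => ?_
    rw [iteratedFDeriv_two_apply]
    have h : Differentiable ℝ (fderiv ℝ f) :=
      (hf.fderiv_right (m := (⊤ : ℕ∞)) (by simp)).differentiable (by simp)
    unfold pd
    rw [fderiv_clm_apply (h y) (by fun_prop)]
    simp
  have hL := lapR_eq hf (T x)
  have e1 := key (EuclideanSpace.basisFun (Fin 2) ℝ) (T x)
  have e2 := key ((EuclideanSpace.basisFun (Fin 2) ℝ).map T) (T x)
  simp only [EuclideanSpace.basisFun_apply, OrthonormalBasis.map_apply] at e1 e2
  rw [hL, ← e1, e2]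
  have hc : ContDiff ℝ (⊤ : ℕ∞) (fun y => f (T y)) := hf.comp T.contDiff
  rw [lapR_eq hc]
  have hp : ∀ (v : Pt) {k : Pt → ℝ}, ContDiff ℝ (⊤ : ℕ∞) k →
      pd v (fun y => k (T y)) = fun y => pd (T v) k (T y) := by
    intro v k hk
    ext y
    refine pd_eq v (smooth_diff (hk.comp T.contDiff)) ?_
    simpa using hasDerivAt_line0 (T v) (smooth_diff hk) (T y)
  refine Finset.sum_congr rfl fun i _ => ?_
  rw [hp _ hf, hp _ (pd_contDiff _ hf)]

lemma integral_pd_eq_zero (v : Pt) {F : Pt → ℝ} (hF : ContDiff ℝ (⊤ : ℕ∞) F)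
    (hs : HasCompactSupport F) : ∫ x, pd v F x = 0 := by
  have h := integral_mul_fderiv_eq_neg_fderiv_mul_of_integrable (μ := (volume : Measure Pt))
    (f := fun _ => (1:ℝ)) (g := F) (v := v) (by simp)
    (by
      have : Continuous (pd v F) := (pd_contDiff v hF).continuous
      have h2 := this.integrable_of_hasCompactSupport (μ := volume) (hs.fderiv_apply (𝕜 := ℝ) v)
      refine h2.congr (Eventually.of_forall fun x => ?_)
      simp [pd])
    (by simpa using hF.continuous.integrable_of_hasCompactSupport hs)
    (by intros; fun_prop) (by intro x _; exact smooth_diff hF x)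
  simpa [pd] using h

lemma pd_hasCompactSupport (v : Pt) {F : Pt → ℝ} (hs : HasCompactSupport F) :
    HasCompactSupport (pd v F) := hs.fderiv_apply (𝕜 := ℝ) v

lemma picone (v : Pt) {u w χ : Pt → ℝ} (hu : ContDiff ℝ (⊤ : ℕ∞) u)
    (hw : ContDiff ℝ (⊤ : ℕ∞) w) (hχ : ContDiff ℝ (⊤ : ℕ∞) χ) (hs : HasCompactSupport χ)
    (pu : ∀ x, 0 < u x) (pw : ∀ x, 0 < w x) :
    ∫ x, χ x ^ 2 * ((u x ^ 2 - w x ^ 2) * (pd v (pd v u) x / u x - pd v (pd v w) x / w x))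
      ≤ ∫ x, pd v χ x ^ 2 * (u x ^ 2 + w x ^ 2) := by
  have hu' := pd_contDiff v hu
  have hw' := pd_contDiff v hw
  have hχ' := pd_contDiff v hχ
  have hu'' := pd_contDiff v hu'
  have hw'' := pd_contDiff v hw'
  have nu : ∀ x, u x ≠ 0 := fun x => (pu x).ne'
  have nw : ∀ x, w x ≠ 0 := fun x => (pw x).ne'
  set F : Pt → ℝ := fun x => χ x ^ 2 * ((u x ^ 2 - w x ^ 2) * (pd v u x / u x - pd v w x / w x))
    with hFdef
  have hF : ContDiff ℝ (⊤ : ℕ∞) F :=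
    (hχ.pow 2).mul (((hu.pow 2).sub (hw.pow 2)).mul ((hu'.div hu nu).sub (hw'.div hw nw)))
  have s2 : HasCompactSupport (fun x => χ x ^ 2) := by
    simp only [pow_two]; exact hs.mul_left (f := χ)
  have hsF : HasCompactSupport F := s2.mul_right
  have h0 := integral_pd_eq_zero v hF hsF
  have i1 : Integrable (fun x => χ x ^ 2 * ((u x ^ 2 - w x ^ 2) *
      (pd v (pd v u) x / u x - pd v (pd v w) x / w x))) := by
    refine Continuous.integrable_of_hasCompactSupport ?_ s2.mul_right
    exact ((hχ.pow 2).mul (((hu.pow 2).sub (hw.pow 2)).mul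
      ((hu''.div hu nu).sub (hw''.div hw nw)))).continuous
  have i2 : Integrable (fun x => pd v χ x ^ 2 * (u x ^ 2 + w x ^ 2)) := by
    have s3 : HasCompactSupport (fun x => pd v χ x ^ 2) := by
      simp only [pow_two]; exact (pd_hasCompactSupport v hs).mul_left (f := pd v χ)
    refine Continuous.integrable_of_hasCompactSupport ?_ s3.mul_right
    exact ((hχ'.pow 2).mul ((hu.pow 2).add (hw.pow 2))).continuous
  have i3 : Integrable (pd v F) :=
    (pd_contDiff v hF).continuous.integrable_of_hasCompactSupport (pd_hasCompactSupport v hsF)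
  have hm := integral_mono i1 (i2.add i3) ?_
  · simp only [Pi.add_apply] at hm
    rw [integral_add i2 i3, h0, add_zero] at hm
    exact hm
  intro x
  rw [← sub_nonneg]
  have d1 := hasDerivAt_line0 v (smooth_diff hu) x
  have d2 := hasDerivAt_line0 v (smooth_diff hw) x
  have d3 := hasDerivAt_line0 v (smooth_diff hχ) x
  have d4 := hasDerivAt_line0 v (smooth_diff hu') x
  have d5 := hasDerivAt_line0 v (smooth_diff hw') x
  have dF := (d3.pow 2).mul (((d1.pow 2).sub (d2.pow 2)).mul
    ((d4.div d1 (by simpa using nu x)).sub (d5.div d2 (by simpa using nw x))))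
  have e := pd_eq v (smooth_diff hF) dF
  simp only [zero_smul, add_zero] at e
  simp only [Pi.add_apply]
  rw [e]
  have h1 := pu x
  have h2 := pw x
  simp only [Pi.pow_apply, Pi.mul_apply, Pi.sub_apply, Pi.div_apply, zero_smul, add_zero]
  generalize pd v (pd v u) x = a2
  generalize pd v (pd v w) x = b2
  generalize pd v u x = a1 at *
  generalize pd v w x = b1 at *
  generalize pd v χ x = c1 at *
  generalize χ x = c at *
  generalize u x = a at *
  generalize w x = b at *
  -- the expression is a square plus a nonnegative remainder
  have key : c1 ^ 2 * (a ^ 2 + b ^ 2) + 2 * c * c1 * (a ^ 2 - b ^ 2) * (a1 / a - b1 / b)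
      + c ^ 2 * (a ^ 2 + b ^ 2) * (a1 / a - b1 / b) ^ 2 ≥ 0 := by
    nlinarith [sq_nonneg (a * (c1 + c * (a1 / a - b1 / b))),
      sq_nonneg (b * (c1 - c * (a1 / a - b1 / b)))]
  refine le_of_le_of_eq key ?_
  have ha := h1.ne'
  have hb := h2.ne'
  field_simp
  ring

lemma picone_int (v : Pt) {u w χ : Pt → ℝ} (hu : ContDiff ℝ (⊤ : ℕ∞) u)
    (hw : ContDiff ℝ (⊤ : ℕ∞) w) (hχ : ContDiff ℝ (⊤ : ℕ∞) χ) (hs : HasCompactSupport χ)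
    (pu : ∀ x, 0 < u x) (pw : ∀ x, 0 < w x) :
    Integrable (fun x => χ x ^ 2 * ((u x ^ 2 - w x ^ 2) *
      (pd v (pd v u) x / u x - pd v (pd v w) x / w x))) := by
  have hu'' := pd_contDiff v (pd_contDiff v hu)
  have hw'' := pd_contDiff v (pd_contDiff v hw)
  have nu : ∀ x, u x ≠ 0 := fun x => (pu x).ne'
  have nw : ∀ x, w x ≠ 0 := fun x => (pw x).ne'
  have s2 : HasCompactSupport (fun x => χ x ^ 2) := by
    simp only [pow_two]; exact hs.mul_left (f := χ)
  refine Continuous.integrable_of_hasCompactSupport ?_ s2.mul_right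
  exact ((hχ.pow 2).mul (((hu.pow 2).sub (hw.pow 2)).mul
      ((hu''.div hu nu).sub (hw''.div hw nw)))).continuous

lemma bounded_of_tendsto {S : Pt → ℝ} (hS : Continuous S) (h0 : Tendsto S (cocompact Pt) (𝓝 0)) :
    ∃ M, ∀ x, |S x| ≤ M := by
  let f : ZeroAtInftyContinuousMap Pt ℝ := ⟨⟨S, hS⟩, h0⟩
  obtain ⟨M, hM⟩ := (ZeroAtInftyContinuousMap.isBounded_range f).exists_norm_le
  exact ⟨M, fun x => hM _ ⟨x, rfl⟩⟩

lemma cutoff_tendsto (v : Pt) {φ S : Pt → ℝ} (hφ : ContDiff ℝ (⊤ : ℕ∞) φ)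
    (hs : HasCompactSupport φ) (hS : Continuous S) (h0 : Tendsto S (cocompact Pt) (𝓝 0)) :
    Tendsto (fun n : ℕ => ∫ x, pd v (fun y => φ (((n:ℝ)+1)⁻¹ • y)) x ^ 2 * S x) atTop (𝓝 0) := by
  obtain ⟨M, hM⟩ := bounded_of_tendsto hS h0
  have hφ' := (pd_contDiff v hφ).continuous
  have e : ∀ n : ℕ, ∫ x, pd v (fun y => φ (((n:ℝ)+1)⁻¹ • y)) x ^ 2 * S x
      = ∫ x, pd v φ x ^ 2 * S (((n:ℝ)+1) • x) := by
    intro n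
    have hR : (0:ℝ) < (n:ℝ)+1 := by positivity
    set R : ℝ := (n:ℝ)+1
    have hp : ∀ x, pd v (fun y => φ (R⁻¹ • y)) x = R⁻¹ * pd v φ (R⁻¹ • x) := by
      intro x
      refine pd_eq v (smooth_diff (hφ.comp (contDiff_id.const_smul R⁻¹))) ?_
      have h1 : HasDerivAt (fun t : ℝ => R⁻¹ * t) R⁻¹ 0 := by
        simpa using (hasDerivAt_id (0:ℝ)).const_mul R⁻¹
      have h2 : HasDerivAt (fun t : ℝ => φ (R⁻¹ • x + t • v)) (pd v φ (R⁻¹ • x)) (R⁻¹ * 0) := by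
        simpa using hasDerivAt_line0 v (smooth_diff hφ) (R⁻¹ • x)
      have h3 := h2.comp 0 h1
      rw [mul_comm]
      refine h3.congr_of_eventuallyEq (Eventually.of_forall fun t => ?_)
      simp [smul_smul]
    have := Measure.integral_comp_inv_smul (μ := (volume : Measure Pt))
      (fun y => (R⁻¹) ^ 2 * (pd v φ y ^ 2 * S (R • y))) R
    simp only [finrank_euclideanSpace, Fintype.card_fin, smul_eq_mul,
      smul_inv_smul₀ hR.ne'] at this
    simp only [integral_const_mul] at this
    rw [abs_of_pos (by positivity), ← mul_assoc, ← mul_pow, mul_inv_cancel₀ hR.ne', one_pow,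
      one_mul] at this
    rw [← this, ← integral_const_mul]
    refine integral_congr_ae (Eventually.of_forall fun x => ?_)
    simp only [hp]
    ring
  simp only [e]
  have s3 : HasCompactSupport (fun x => pd v φ x ^ 2) := by
    simp only [pow_two]; exact (pd_hasCompactSupport v hs).mul_left (f := pd v φ)
  have hlim : Tendsto (fun n : ℕ => ∫ x, pd v φ x ^ 2 * S (((n:ℝ)+1) • x)) atTop
      (𝓝 (∫ _ : Pt, (0:ℝ))) := by
    refine tendsto_integral_of_dominated_convergence (fun x => pd v φ x ^ 2 * M) ?_ ?_ ?_ ?_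
    · intro n
      have : Continuous (fun x => pd v φ x ^ 2 * S (((n:ℝ)+1) • x)) := by fun_prop
      exact this.aestronglyMeasurable
    · exact ((hφ'.pow 2).mul continuous_const).integrable_of_hasCompactSupport s3.mul_right
    · intro n
      refine Eventually.of_forall fun x => ?_
      rw [Real.norm_eq_abs, abs_mul, abs_of_nonneg (sq_nonneg _)]
      exact mul_le_mul_of_nonneg_left (hM _) (sq_nonneg _)
    · have hne : ∀ᵐ x : Pt, x ≠ 0 := by
        simp [ae_iff]
      filter_upwards [hne] with x hx
      have h1 : Tendsto (fun n : ℕ => ((n:ℝ)+1) • x) atTop (cocompact Pt) := by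
        refine tendsto_cocompact_of_tendsto_dist_comp_atTop 0 ?_
        simp only [dist_zero_right, norm_smul]
        refine Tendsto.atTop_mul_const (norm_pos_iff.mpr hx) ?_
        refine tendsto_norm_atTop_atTop.comp ?_
        exact tendsto_natCast_atTop_atTop.atTop_add tendsto_const_nhds
      simpa using (h0.comp h1).const_mul (pd v φ x ^ 2)
  simpa using hlim

lemma main_ineq {g₁ g₂ g ε lam₁ lam₂ : ℝ} (hε : 0 < ε) {η₁ η₂ u₁ u₂ χ : Pt → ℝ}
    (hη : GPPositiveSolution g₁ g₂ g ε lam₁ lam₂ η₁ η₂)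
    (hu : GPPositiveSolution g₁ g₂ g ε lam₁ lam₂ u₁ u₂)
    (hχ : ContDiff ℝ (⊤ : ℕ∞) χ) (hs : HasCompactSupport χ) :
    ∫ x, χ x ^ 2 * (g₁ * (u₁ x ^ 2 - η₁ x ^ 2) ^ 2
        + 2 * g * (u₁ x ^ 2 - η₁ x ^ 2) * (u₂ x ^ 2 - η₂ x ^ 2)
        + g₂ * (u₂ x ^ 2 - η₂ x ^ 2) ^ 2)
      ≤ ε ^ 2 * ∑ i : Fin 2,
        ((∫ x, pd (EuclideanSpace.single i (1:ℝ)) χ x ^ 2 * (u₁ x ^ 2 + η₁ x ^ 2))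
        + ∫ x, pd (EuclideanSpace.single i (1:ℝ)) χ x ^ 2 * (u₂ x ^ 2 + η₂ x ^ 2)) := by
  obtain ⟨⟨a1, a2, a3, a4, a5, a6⟩, p1, p2⟩ := hη
  obtain ⟨⟨b1, b2, b3, b4, b5, b6⟩, q1, q2⟩ := hu
  have hle : ∀ i : Fin 2, _ := fun i => add_le_add
    (picone (EuclideanSpace.single i (1:ℝ)) b1 a1 hχ hs q1 p1)
    (picone (EuclideanSpace.single i (1:ℝ)) b2 a2 hχ hs q2 p2)
  refine le_trans (le_of_eq ?_)
    (mul_le_mul_of_nonneg_left (Finset.sum_le_sum fun i _ => hle i) (sq_nonneg ε))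
  have I1 := fun i : Fin 2 => picone_int (EuclideanSpace.single i (1:ℝ)) b1 a1 hχ hs q1 p1
  have I2 := fun i : Fin 2 => picone_int (EuclideanSpace.single i (1:ℝ)) b2 a2 hχ hs q2 p2
  simp only [← integral_add (I1 _) (I2 _)]
  rw [Fin.sum_univ_two]
  have hadd := integral_add ((I1 0).add (I2 0)) ((I1 1).add (I2 1))
  simp only [Pi.add_apply] at hadd
  rw [← hadd, ← integral_const_mul]
  refine integral_congr_ae (Eventually.of_forall fun x => ?_)
  have l1 := a3 x
  have l2 := a4 x
  have l3 := b3 x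
  have l4 := b4 x
  rw [lapR_eq a1] at l1
  rw [lapR_eq a2] at l2
  rw [lapR_eq b1] at l3
  rw [lapR_eq b2] at l4
  have n1 := (p1 x).ne'
  have n2 := (p2 x).ne'
  have m1 := (q1 x).ne'
  have m2 := (q2 x).ne'
  simp only [Fin.sum_univ_two] at l1 l2 l3 l4 ⊢
  generalize EuclideanSpace.single (0:Fin 2) (1:ℝ) = e0 at *
  generalize EuclideanSpace.single (1:Fin 2) (1:ℝ) = e1 at *
  have k1 : ε ^ 2 * (pd e0 (pd e0 η₁) x / η₁ x + pd e1 (pd e1 η₁) x / η₁ x)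
      = ‖x‖ ^ 2 + g₁ * η₁ x ^ 2 + g * η₂ x ^ 2 - lam₁ := by
    field_simp; linear_combination -l1
  have k2 : ε ^ 2 * (pd e0 (pd e0 η₂) x / η₂ x + pd e1 (pd e1 η₂) x / η₂ x)
      = ‖x‖ ^ 2 + g₂ * η₂ x ^ 2 + g * η₁ x ^ 2 - lam₂ := by
    field_simp; linear_combination -l2
  have k3 : ε ^ 2 * (pd e0 (pd e0 u₁) x / u₁ x + pd e1 (pd e1 u₁) x / u₁ x)
      = ‖x‖ ^ 2 + g₁ * u₁ x ^ 2 + g * u₂ x ^ 2 - lam₁ := by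
    field_simp; linear_combination -l3
  have k4 : ε ^ 2 * (pd e0 (pd e0 u₂) x / u₂ x + pd e1 (pd e1 u₂) x / u₂ x)
      = ‖x‖ ^ 2 + g₂ * u₂ x ^ 2 + g * u₁ x ^ 2 - lam₂ := by
    field_simp; linear_combination -l4
  linear_combination (χ x ^ 2 * (u₁ x ^ 2 - η₁ x ^ 2)) * (k1 - k3)
    + (χ x ^ 2 * (u₂ x ^ 2 - η₂ x ^ 2)) * (k2 - k4)

lemma uniq {g₁ g₂ g ε lam₁ lam₂ : ℝ}
    (hg₁ : 0 < g₁) (hε : 0 < ε)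
    (hcoex : g ^ 2 < g₁ * g₂) {η₁ η₂ u₁ u₂ : Pt → ℝ}
    (hη : GPPositiveSolution g₁ g₂ g ε lam₁ lam₂ η₁ η₂)
    (hu : GPPositiveSolution g₁ g₂ g ε lam₁ lam₂ u₁ u₂) (x : Pt) :
    u₁ x = η₁ x ∧ u₂ x = η₂ x := by
  have key := fun χ => main_ineq (χ := χ) hε hη hu
  obtain ⟨⟨a1, a2, a3, a4, a5, a6⟩, p1, p2⟩ := hη
  obtain ⟨⟨b1, b2, b3, b4, b5, b6⟩, q1, q2⟩ := hu
  have ca1 := a1.continuous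
  have ca2 := a2.continuous
  have cb1 := b1.continuous
  have cb2 := b2.continuous
  let Q : Pt → ℝ := fun x => g₁ * (u₁ x ^ 2 - η₁ x ^ 2) ^ 2
        + 2 * g * (u₁ x ^ 2 - η₁ x ^ 2) * (u₂ x ^ 2 - η₂ x ^ 2)
        + g₂ * (u₂ x ^ 2 - η₂ x ^ 2) ^ 2
  have hQ : ∀ x, g₁ * Q x = (g₁ * (u₁ x ^ 2 - η₁ x ^ 2) + g * (u₂ x ^ 2 - η₂ x ^ 2)) ^ 2
      + (g₁ * g₂ - g ^ 2) * (u₂ x ^ 2 - η₂ x ^ 2) ^ 2 := fun x => by simp only [Q]; ring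
  have hd : 0 < g₁ * g₂ - g ^ 2 := by linarith
  have Qn : ∀ x, 0 ≤ Q x := fun x => by
    have : 0 ≤ g₁ * Q x := by rw [hQ]; positivity
    exact nonneg_of_mul_nonneg_right this hg₁
  have Qc : Continuous Q := by fun_prop
  let φ : ContDiffBump (0 : Pt) := ⟨1, 2, one_pos, one_lt_two⟩
  have hφ : ContDiff ℝ (⊤ : ℕ∞) φ := φ.contDiff
  have sφ : HasCompactSupport φ := φ.hasCompactSupport
  let χ : ℕ → Pt → ℝ := fun n y => φ (((n:ℝ)+1)⁻¹ • y)
  have hχ : ∀ n, ContDiff ℝ (⊤ : ℕ∞) (χ n) := fun n => hφ.comp (contDiff_id.const_smul _)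
  have sχ : ∀ n, HasCompactSupport (χ n) := fun n =>
    sφ.comp_smul (c := ((n:ℝ)+1)⁻¹) (by positivity)
  have hlim : Tendsto (fun n : ℕ => ∫ x, χ n x ^ 2 * Q x) atTop (𝓝 0) := by
    have hS1 : Tendsto (fun x => u₁ x ^ 2 + η₁ x ^ 2) (cocompact Pt) (𝓝 0) := by
      simpa using (b5.pow 2).add (a5.pow 2)
    have hS2 : Tendsto (fun x => u₂ x ^ 2 + η₂ x ^ 2) (cocompact Pt) (𝓝 0) := by
      simpa using (b6.pow 2).add (a6.pow 2)
    have t : ∀ i : Fin 2, _ := fun i =>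
      (cutoff_tendsto (EuclideanSpace.single i (1:ℝ)) hφ sφ (by fun_prop) hS1).add
      (cutoff_tendsto (EuclideanSpace.single i (1:ℝ)) hφ sφ (by fun_prop) hS2)
    have t2 := (tendsto_finsetSum Finset.univ fun i _ => t i).const_mul (ε ^ 2)
    simp only [add_zero, Finset.sum_const_zero, mul_zero] at t2
    refine squeeze_zero (fun n => integral_nonneg fun x => mul_nonneg (sq_nonneg _) (Qn x))
      (fun n => key (χ n) (hχ n) (sχ n)) t2
  have iφ : ∀ n, Integrable (fun x => χ n x ^ 2 * Q x) := fun n => by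
    have s2 : HasCompactSupport (fun x => χ n x ^ 2) := by
      simp only [pow_two]; exact (sχ n).mul_left (f := χ n)
    exact (((hχ n).continuous.pow 2).mul Qc).integrable_of_hasCompactSupport s2.mul_right
  have Q0 : Q x = 0 := by
    by_contra hne
    obtain ⟨k, hk⟩ := exists_nat_ge ‖x‖
    have sk : HasCompactSupport (fun x => χ k x ^ 2 * Q x) := by
      have s2 : HasCompactSupport (fun x => χ k x ^ 2) := by
        simp only [pow_two]; exact (sχ k).mul_left (f := χ k)
      exact s2.mul_right
    have one : ∀ (n : ℕ) (y : Pt), ‖y‖ ≤ (n:ℝ) + 1 → χ n y = 1 := by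
      intro n y hy
      refine φ.one_of_mem_closedBall ?_
      simp only [mem_closedBall_zero_iff, norm_smul, norm_inv, φ]
      rw [Real.norm_of_nonneg (by positivity)]
      exact inv_mul_le_one_of_le₀ hy (by positivity)
    have zero : ∀ (n : ℕ) (y : Pt), 2 * ((n:ℝ) + 1) ≤ ‖y‖ → χ n y = 0 := by
      intro n y hy
      refine φ.zero_of_le_dist ?_
      simp only [dist_zero_right, norm_smul, norm_inv, φ]
      rw [Real.norm_of_nonneg (by positivity), inv_mul_eq_div, le_div_iff₀ (by positivity)]
      exact hy
    have hpos : 0 < ∫ x, χ k x ^ 2 * Q x := by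
      refine Continuous.integral_pos_of_hasCompactSupport_nonneg_nonzero
        (((hχ k).continuous.pow 2).mul Qc) sk (fun y => mul_nonneg (sq_nonneg _) (Qn y))
        (x := x) ?_
      rw [one k x (by linarith)]
      simpa using hne
    have hle : ∀ᶠ n : ℕ in atTop, ∫ x, χ k x ^ 2 * Q x ≤ ∫ x, χ n x ^ 2 * Q x := by
      filter_upwards [eventually_ge_atTop (2 * k + 2)] with n hn
      refine integral_mono (iφ k) (iφ n) fun y => ?_
      refine mul_le_mul_of_nonneg_right ?_ (Qn y)
      have hn' : 2 * (k:ℝ) + 2 ≤ n := by exact_mod_cast hn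
      rcases le_total (2 * ((k:ℝ) + 1)) ‖y‖ with h | h
      · rw [zero k y h]; simpa using sq_nonneg _
      · rw [one n y (by linarith)]
        exact pow_le_pow_left₀ φ.nonneg φ.le_one 2
    have := ge_of_tendsto hlim hle
    linarith
  have h := hQ x
  rw [Q0, mul_zero] at h
  have hB : (u₂ x ^ 2 - η₂ x ^ 2) ^ 2 = 0 := by
    by_contra hne
    have : 0 < (u₂ x ^ 2 - η₂ x ^ 2) ^ 2 := lt_of_le_of_ne (sq_nonneg _) (Ne.symm hne)
    nlinarith [mul_pos hd this, sq_nonneg (g₁ * (u₁ x ^ 2 - η₁ x ^ 2) + g * (u₂ x ^ 2 - η₂ x ^ 2))]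
  have hB' := pow_eq_zero_iff (two_ne_zero) |>.mp hB
  rw [hB'] at h
  have hA : u₁ x ^ 2 - η₁ x ^ 2 = 0 := by
    have : (g₁ * (u₁ x ^ 2 - η₁ x ^ 2)) ^ 2 = 0 := by linarith
    have := pow_eq_zero_iff (two_ne_zero) |>.mp this
    exact (mul_eq_zero.mp this).resolve_left hg₁.ne'
  exact ⟨(sq_eq_sq₀ (q1 x).le (p1 x).le).mp (by linarith),
    (sq_eq_sq₀ (q2 x).le (p2 x).le).mp (by linarith)⟩

lemma rotate_sol {g₁ g₂ g ε lam₁ lam₂ : ℝ} {η₁ η₂ : Pt → ℝ}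
    (hη : GPPositiveSolution g₁ g₂ g ε lam₁ lam₂ η₁ η₂) (T : Pt ≃ₗᵢ[ℝ] Pt) :
    GPPositiveSolution g₁ g₂ g ε lam₁ lam₂ (fun x => η₁ (T x)) (fun x => η₂ (T x)) := by
  obtain ⟨⟨a1, a2, a3, a4, a5, a6⟩, p1, p2⟩ := hη
  have hT : Tendsto T (cocompact Pt) (cocompact Pt) :=
    T.toHomeomorph.isClosedEmbedding.tendsto_cocompact
  refine ⟨⟨a1.comp T.contDiff, a2.comp T.contDiff, fun x => ?_, fun x => ?_,
    a5.comp hT, a6.comp hT⟩, fun x => p1 _, fun x => p2 _⟩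
  · rw [lapR_isometry a1]
    simpa using a3 (T x)
  · rw [lapR_isometry a2]
    simpa using a4 (T x)

/-- Under the coexistence condition `g² < g₁g₂`, for fixed
`lam₁, lam₂ > 0`, the coupled Gross–Pitaevskii system has at most one positive
solution; in particular any positive solution is radially symmetric. -/
theorem uniqueness_of_positive_solutions
    (g₁ g₂ g ε lam₁ lam₂ : ℝ)
    (hg₁ : 0 < g₁) (hg₂ : 0 < g₂) (hg : 0 < g) (hε : 0 < ε)
    (hcoex : g ^ 2 < g₁ * g₂) (hlam₁ : 0 < lam₁) (hlam₂ : 0 < lam₂)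
    (η₁ η₂ u₁ u₂ : Pt → ℝ)
    (hη : GPPositiveSolution g₁ g₂ g ε lam₁ lam₂ η₁ η₂)
    (hu : GPPositiveSolution g₁ g₂ g ε lam₁ lam₂ u₁ u₂) :
    ((∀ x, u₁ x = η₁ x) ∧ (∀ x, u₂ x = η₂ x)) ∧
    (∀ x y : Pt, ‖x‖ = ‖y‖ → η₁ x = η₁ y ∧ η₂ x = η₂ y) := by
  refine ⟨⟨fun x => (uniq hg₁ hε hcoex hη hu x).1, fun x => (uniq hg₁ hε hcoex hη hu x).2⟩, ?_⟩
  intro x y hxy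
  have h := uniq hg₁ hε hcoex hη (rotate_sol hη (Submodule.reflection (Submodule.span ℝ {x - y})ᗮ)) x
  simp only [Submodule.reflection_sub hxy] at h
  exact ⟨h.1.symm, h.2.symm⟩
end
end

section
/- Let (u₁,u₂) be a positive solution of the coupled Gross–Pitaevskii system with coefficients λ₁,ε > 0 and λ₂,ε > 0. Then u_i² ≤ λ_{i,ε}/g_i on ℝ² for i = 1,2, and there is a constant C > 0 (independent of ε and of λ₁,ε, λ₂,ε) such that ‖∇u_i‖_{L∞(ℝ²)} ≤ C √(λ_{i,ε}) (λ_{i,ε} + λ_{j,ε} + 1)/ε for i = 1,2 and j ≠ i. -/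
open MeasureTheory Filter
open scoped Real Topology

noncomputable section

lemma second_deriv_nonpos {f : ℝ → ℝ} (hf : ContDiff ℝ 2 f) (h : IsLocalMax f 0) :
    iteratedDeriv 2 f 0 ≤ 0 := by
  by_contra hc
  push Not at hc
  have e2 : iteratedDeriv 2 f = deriv (deriv f) := by
    rw [iteratedDeriv_succ, iteratedDeriv_one]
  rw [e2] at hc
  have hmin := isLocalMin_of_deriv_deriv_pos hc h.deriv_eq_zero hf.continuous.continuousAt
  have hconst : f =ᶠ[𝓝 0] fun _ => f 0 := by
    filter_upwards [h, hmin] with x hx hx'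
    exact le_antisymm hx hx'
  have := hconst.deriv.deriv.eq_of_nhds
  simp at this
  linarith

lemma second_deriv_le {f k : ℝ → ℝ} (hf : ContDiff ℝ 2 f) (hk : ContDiff ℝ 2 k)
    (h : IsLocalMax (fun t => f t - k t) 0) :
    iteratedDeriv 2 f 0 ≤ iteratedDeriv 2 k 0 := by
  have h1 := second_deriv_nonpos (hf.sub hk) h
  rw [iteratedDeriv_fun_sub hf.contDiffAt hk.contDiffAt] at h1
  linarith

lemma contDiff_line {u : Pt → ℝ} (hu : ContDiff ℝ 2 u) (x v : Pt) :
    ContDiff ℝ 2 (fun t : ℝ => u (x + t • v)) := by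
  fun_prop

lemma lapR_le {u p : Pt → ℝ} (hu : ContDiff ℝ 2 u) (hp : ContDiff ℝ 2 p) (x : Pt)
    (h : ∀ y, u y - p y ≤ u x - p x) : lapR u x ≤ lapR p x := by
  unfold lapR
  refine Finset.sum_le_sum fun i _ => ?_
  refine second_deriv_le (contDiff_line hu _ _) (contDiff_line hp _ _) ?_
  refine Filter.Eventually.of_forall fun t => ?_
  simpa using h _

def bar (c K a : ℝ) (x : Pt) : ℝ := c + K / (‖x‖ ^ 2 + a)

lemma bar_contDiff (c K a : ℝ) (ha : 0 < a) : ContDiff ℝ 2 (bar c K a) := by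
  unfold bar
  refine contDiff_const.add (contDiff_const.div ((contDiff_norm_sq ℝ).add contDiff_const) ?_)
  intro x; positivity

lemma norm_line (x : Pt) (i : Fin 2) (t : ℝ) :
    ‖x + t • EuclideanSpace.single i (1:ℝ)‖ ^ 2 = ‖x‖ ^ 2 + 2 * x i * t + t ^ 2 := by
  rw [EuclideanSpace.norm_sq_eq, EuclideanSpace.norm_sq_eq]
  fin_cases i <;> simp <;> ring

lemma bar_line (c K p q : ℝ) (hp : 0 < p) (hq : q ^ 2 < p) :
    iteratedDeriv 2 (fun t : ℝ => c + K / (p + 2 * q * t + t ^ 2)) 0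
      = K * (8 * q ^ 2 / p ^ 3 - 2 / p ^ 2) := by
  have hpos : ∀ t : ℝ, p + 2 * q * t + t ^ 2 ≠ 0 := fun t => by nlinarith [sq_nonneg (t + q)]
  have hq' : ∀ t : ℝ, HasDerivAt (fun t : ℝ => p + 2 * q * t + t ^ 2) (2 * q + 2 * t) t := by
    intro t
    have := (((hasDerivAt_id t).const_mul (2 * q)).const_add p).add ((hasDerivAt_id t).pow 2)
    exact this.congr_deriv (by simp)
  have e2 : ∀ f : ℝ → ℝ, iteratedDeriv 2 f = deriv (deriv f) := fun f => by
    rw [iteratedDeriv_succ, iteratedDeriv_one]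
  have d1 : deriv (fun t : ℝ => c + K / (p + 2 * q * t + t ^ 2))
      = fun t => - K * (2 * q + 2 * t) / (p + 2 * q * t + t ^ 2) ^ 2 := by
    funext t
    have := (((hasDerivAt_const t K).div (hq' t) (hpos t)).const_add c).deriv
    refine Eq.trans this ?_
    congr 1
    ring
  rw [e2, d1]
  have hn : HasDerivAt (fun t : ℝ => -K * (2 * q + 2 * t)) (-K * 2) 0 := by
    have := (((hasDerivAt_id (0:ℝ)).const_mul 2).const_add (2 * q)).const_mul (-K)
    exact this.congr_deriv (by simp)
  have := (hn.div ((hq' 0).pow 2) (pow_ne_zero 2 (hpos 0))).deriv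
  refine Eq.trans this ?_
  simp
  field_simp
  ring

lemma bar_lap (c K a : ℝ) (ha : 0 < a) (x : Pt) :
    lapR (bar c K a) x = K * (4 * (‖x‖ ^ 2 - a)) / (‖x‖ ^ 2 + a) ^ 3 := by
  have hs : 0 < ‖x‖ ^ 2 + a := by positivity
  have hx : ‖x‖ ^ 2 = x 0 ^ 2 + x 1 ^ 2 := by
    rw [EuclideanSpace.norm_sq_eq]; simp
  have key : ∀ i : Fin 2, iteratedDeriv 2
      (fun t : ℝ => bar c K a (x + t • EuclideanSpace.single i (1:ℝ))) 0
      = K * (8 * x i ^ 2 / (‖x‖ ^ 2 + a) ^ 3 - 2 / (‖x‖ ^ 2 + a) ^ 2) := by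
    intro i
    rw [← bar_line c K (‖x‖ ^ 2 + a) (x i) hs]
    · congr 1
      funext t
      unfold bar
      rw [norm_line]
      congr 2
      ring
    · rw [hx]; fin_cases i <;> simp <;> nlinarith [sq_nonneg (x 0), sq_nonneg (x 1)]
  unfold lapR
  rw [Fin.sum_univ_two, key, key]
  have h8 : x 0 ^ 2 = ‖x‖ ^ 2 - x 1 ^ 2 := by linarith
  rw [h8]
  field_simp
  ring

/-- A continuous function tending to something nonpositive at infinity and positive somewhere
attains its maximum. -/
lemma exists_max {w : Pt → ℝ} (hw : Continuous w) {x₀ : Pt} (h0 : 0 < w x₀) {u : Pt → ℝ}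
    (hu : Tendsto u (cocompact Pt) (𝓝 0)) (hwu : ∀ x, w x ≤ u x) :
    ∃ x, ∀ y, w y ≤ w x := by
  refine hw.exists_forall_ge' x₀ ?_
  filter_upwards [hu.eventually (gt_mem_nhds h0)] with x hx
  exact (hwu x).trans hx.le

section single

variable {g ε lam B : ℝ} {u b : Pt → ℝ}

lemma sup_bound (hg : 0 < g) (hε : 0 < ε)
    (hu : ContDiff ℝ 2 u) (hb : ∀ x, 0 ≤ b x)
    (heq : ∀ x, ε ^ 2 * lapR u x = (‖x‖ ^ 2 + g * u x ^ 2 + b x - lam) * u x)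
    (hpos : ∀ x, 0 < u x) (hlim : Tendsto u (cocompact Pt) (𝓝 0)) (x : Pt) :
    u x ^ 2 ≤ lam / g := by
  obtain ⟨m, hm⟩ := exists_max hu.continuous (hpos 0) hlim fun _ => le_rfl
  have h1 : lapR u m ≤ lapR (fun _ => (0:ℝ)) m :=
    lapR_le hu contDiff_const m (fun y => by simpa using hm y)
  have h2 : lapR (fun _ => (0:ℝ)) m = 0 := by simp [lapR]
  rw [h2] at h1
  have h3 : (‖m‖ ^ 2 + g * u m ^ 2 + b m - lam) * u m ≤ 0 := by
    rw [← heq]; exact mul_nonpos_of_nonneg_of_nonpos (by positivity) h1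
  have h4 : ‖m‖ ^ 2 + g * u m ^ 2 + b m - lam ≤ 0 := by
    by_contra hc
    push Not at hc
    exact absurd (mul_pos hc (hpos m)) (not_lt.mpr h3)
  have h5 : u x ^ 2 ≤ u m ^ 2 := pow_le_pow_left₀ (hpos x).le (hm x) 2
  rw [le_div_iff₀ hg]
  nlinarith [hb m, sq_nonneg ‖m‖]

lemma eps_bound (hg : 0 < g) (hε : 0 < ε)
    (hu : ContDiff ℝ 2 u) (hb : ∀ x, 0 ≤ b x)
    (heq : ∀ x, ε ^ 2 * lapR u x = (‖x‖ ^ 2 + g * u x ^ 2 + b x - lam) * u x)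
    (hpos : ∀ x, 0 < u x) (hlim : Tendsto u (cocompact Pt) (𝓝 0)) :
    ε ≤ 2 * lam := by
  by_contra hc
  push Not at hc
  have hφ : ∀ x, 1 ≤ bar 1 (2 * ε) (2 * ε) x := fun x => by
    unfold bar
    have : 0 ≤ 2 * ε / (‖x‖ ^ 2 + 2 * ε) := by positivity
    linarith
  have hφc := bar_contDiff 1 (2 * ε) (2 * ε) (by linarith)
  obtain ⟨m, hm⟩ := exists_max (w := fun x => u x / bar 1 (2 * ε) (2 * ε) x) (x₀ := 0)
    (hu.continuous.div hφc.continuous fun x => by linarith [hφ x])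
    (div_pos (hpos 0) (by linarith [hφ 0])) hlim
    (fun x => div_le_self (hpos x).le (hφ x))
  set t := u m / bar 1 (2 * ε) (2 * ε) m with ht
  have htp : 0 < t := div_pos (hpos m) (by linarith [hφ m])
  have hbar : ∀ x, bar t (t * (2 * ε)) (2 * ε) x = t * bar 1 (2 * ε) (2 * ε) x := fun x => by
    unfold bar; ring
  have hum : u m = t * bar 1 (2 * ε) (2 * ε) m := by
    rw [ht, div_mul_cancel₀]; linarith [hφ m]
  have h1 : lapR u m ≤ lapR (bar t (t * (2 * ε)) (2 * ε)) m := by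
    refine lapR_le hu (bar_contDiff _ _ _ (by linarith)) m fun y => ?_
    rw [hbar, hbar, ← hum, sub_self]
    have := hm y
    rw [div_le_iff₀ (by linarith [hφ y])] at this
    linarith
  rw [bar_lap _ _ _ (by linarith)] at h1
  have h2 : (‖m‖ ^ 2 - lam) * u m ≤ ε ^ 2 * lapR u m := by
    rw [heq]
    refine mul_le_mul_of_nonneg_right ?_ (hpos m).le
    nlinarith [hb m, sq_nonneg (u m)]
  have h3 := h2.trans (mul_le_mul_of_nonneg_left h1 (sq_nonneg ε))
  rw [hum] at h3
  unfold bar at h3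
  set r := ‖m‖ ^ 2 with hr
  have hr0 : 0 ≤ r := sq_nonneg _
  have hs : 0 < r + 2 * ε := by linarith
  have h4 : t * ((r - lam) * (r + 4 * ε) * (r + 2 * ε) ^ 2 / (r + 2 * ε) ^ 3)
      ≤ t * (8 * ε ^ 3 * (r - 2 * ε) / (r + 2 * ε) ^ 3) := by
    refine le_of_eq_of_le ?_ (h3.trans_eq ?_)
    · field_simp; ring
    · ring
  have h5 := le_of_mul_le_mul_left h4 htp
  rw [div_le_div_iff_of_pos_right (by positivity)] at h5
  have h6 : (r - ε / 2) * (r + 4 * ε) * (r + 2 * ε) ^ 2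
      ≤ (r - lam) * (r + 4 * ε) * (r + 2 * ε) ^ 2 := by
    gcongr; linarith
  have h7 := h6.trans h5
  have h8 : 0 < r ^ 4 + 15 / 2 * r ^ 3 * ε + ε ^ 2 * (15 * r ^ 2 + (r - ε) ^ 2 + 7 * ε ^ 2) := by
    positivity
  nlinarith

lemma decay_bound (hg : 0 < g) (hε : 0 < ε) (hlam : 0 < lam)
    (hu : ContDiff ℝ 2 u) (hb : ∀ x, 0 ≤ b x)
    (heq : ∀ x, ε ^ 2 * lapR u x = (‖x‖ ^ 2 + g * u x ^ 2 + b x - lam) * u x)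
    (hpos : ∀ x, 0 < u x) (hlim : Tendsto u (cocompact Pt) (𝓝 0)) {M : ℝ}
    (hM : ∀ x, u x ≤ M) (x : Pt) :
    ‖x‖ ^ 2 * u x ≤ M * (lam + 3 * ε) := by
  have hM0 : 0 < M := (hpos 0).trans_le (hM 0)
  set K := M * (lam + 3 * ε) with hK
  have hKp : 0 < K := by positivity
  have hφc := bar_contDiff 0 K ε hε
  have main : ∀ x, u x - bar 0 K ε x ≤ 0 := by
    by_contra hc
    push Not at hc
    obtain ⟨x₀, hx₀⟩ := hc
    have hφ0 : ∀ x, 0 < bar 0 K ε x := fun x => by unfold bar; positivity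
    obtain ⟨m, hm⟩ := exists_max (w := fun x => u x - bar 0 K ε x)
      (hu.continuous.sub hφc.continuous) hx₀ hlim (fun x => by linarith [hφ0 x])
    have hwm : bar 0 K ε m < u m := by linarith [hm x₀]
    have h1 := lapR_le hu hφc m hm
    rw [bar_lap _ _ _ hε] at h1
    have h2 : (‖m‖ ^ 2 - lam) * u m ≤ ε ^ 2 * lapR u m := by
      rw [heq]
      refine mul_le_mul_of_nonneg_right ?_ (hpos m).le
      nlinarith [hb m, sq_nonneg (u m)]
    have h3 := h2.trans (mul_le_mul_of_nonneg_left h1 (sq_nonneg ε))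
    unfold bar at hwm
    set r := ‖m‖ ^ 2 with hr
    have hr0 : 0 ≤ r := sq_nonneg _
    have hs : 0 < r + ε := by linarith
    have hrl : lam + 2 * ε < r := by
      have : K / (r + ε) < M := by linarith [hM m]
      rw [div_lt_iff₀ hs, hK] at this
      have := lt_of_mul_lt_mul_left this hM0.le
      linarith
    have h4 : (r - lam) * (K / (r + ε)) < (r - lam) * u m :=
      mul_lt_mul_of_pos_left (by linarith) (by linarith)
    have h5 := h4.trans_le h3
    have h6 : K * ((r - lam) * (r + ε) ^ 2 / (r + ε) ^ 3)
        < K * (4 * ε ^ 2 * (r - ε) / (r + ε) ^ 3) := by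
      refine lt_of_eq_of_lt ?_ (h5.trans_eq ?_)
      · field_simp
      · ring
    have h7 := lt_of_mul_lt_mul_left h6 hKp.le
    rw [div_lt_div_iff_of_pos_right (by positivity)] at h7
    have h8 : 2 * ε * (2 * ε) ≤ (r - lam) * (r + ε) := by
      apply mul_le_mul <;> linarith
    nlinarith [mul_le_mul_of_nonneg_right h8 hs.le, pow_pos hε 3]
  have := main x
  unfold bar at this
  have hs : 0 < ‖x‖ ^ 2 + ε := by positivity
  have h2 : u x ≤ K / (‖x‖ ^ 2 + ε) := by linarith
  rw [le_div_iff₀ hs] at h2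
  nlinarith [hpos x]

end single

/-- One-sided interior gradient estimate, by comparison on a half square. -/
lemma grad_one {u : Pt → ℝ} (hu : ContDiff ℝ 2 u) {e f : Pt}
    {M N d : ℝ} (hd : 0 < d) (hM : ∀ x, |u x| ≤ M)
    (hN : ∀ x, |iteratedDeriv 2 (fun t : ℝ => u (x + t • e)) 0
      + iteratedDeriv 2 (fun t : ℝ => u (x + t • f)) 0| < N) (x : Pt) :
    fderiv ℝ u x e ≤ 2 * M / d + N * d / 2 := by
  have hM0 : 0 ≤ M := (abs_nonneg _).trans (hM 0)
  have hN0 : 0 < N := (abs_nonneg _).trans_lt (hN 0)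
  let v : ℝ → ℝ → ℝ := fun s t => (u (x + t • f + s • e) - u (x + t • f + (-s) • e)) / 2
  let ψ : ℝ → ℝ → ℝ := fun s t =>
    M / d ^ 2 * (t ^ 2 + s * (2 * d - s)) + N / 2 * (s * (d - s))
  have hvM : ∀ s t, v s t ≤ M := by
    intro s t
    have h1 := abs_le.mp (hM (x + t • f + s • e))
    have h2 := abs_le.mp (hM (x + t • f + (-s) • e))
    simp only [v]; linarith
  have hMd : 0 ≤ M / d ^ 2 := by positivity
  have hMd' : M / d ^ 2 * d ^ 2 = M := by field_simp
  have main : ∀ s ∈ Set.Icc 0 d, ∀ t ∈ Set.Icc (-d) d, v s t - ψ s t ≤ 0 := by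
    have hcomp : IsCompact (Set.Icc (0:ℝ) d ×ˢ Set.Icc (-d) d) := isCompact_Icc.prod isCompact_Icc
    have huc := hu.continuous
    obtain ⟨⟨s₀, t₀⟩, hmem, hmax⟩ := hcomp.exists_isMaxOn
      (f := fun p : ℝ × ℝ => v p.1 p.2 - ψ p.1 p.2) ⟨(0, 0), by simp [hd.le]⟩
      (by apply Continuous.continuousOn; simp only [v, ψ]; fun_prop)
    simp only [Set.mem_prod, Set.mem_Icc] at hmem
    obtain ⟨⟨hs1, hs2⟩, ht1, ht2⟩ := hmem
    have hmax' : ∀ s ∈ Set.Icc 0 d, ∀ t ∈ Set.Icc (-d) d, v s t - ψ s t ≤ v s₀ t₀ - ψ s₀ t₀ :=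
      fun s hs t ht => isMaxOn_iff.mp hmax (s, t) ⟨hs, ht⟩
    suffices h : v s₀ t₀ - ψ s₀ t₀ ≤ 0 from fun s hs t ht => (hmax' s hs t ht).trans h
    have hq1 : 0 ≤ s₀ * (2 * d - s₀) := mul_nonneg hs1 (by linarith)
    have hq2 : 0 ≤ N / 2 * (s₀ * (d - s₀)) :=
      mul_nonneg (by linarith) (mul_nonneg hs1 (by linarith))
    -- boundary points where `ψ` is at least `M`
    have hbd : d ^ 2 ≤ t₀ ^ 2 + s₀ * (2 * d - s₀) → v s₀ t₀ - ψ s₀ t₀ ≤ 0 := by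
      intro h
      have := mul_le_mul_of_nonneg_left h hMd
      have := hvM s₀ t₀
      simp only [ψ]; linarith
    rcases hs1.eq_or_lt with h0 | h0
    · subst h0
      have : 0 ≤ M / d ^ 2 * t₀ ^ 2 := by positivity
      simp [v, ψ]
      linarith
    rcases hs2.eq_or_lt with h1 | h1
    · apply hbd; subst h1; nlinarith
    rcases ht1.eq_or_lt with h2 | h2
    · apply hbd; rw [← h2]; nlinarith
    rcases ht2.eq_or_lt with h3 | h3
    · apply hbd; rw [h3]; nlinarith
    exfalso
    set P := x + t₀ • f + s₀ • e with hP
    set Q := x + t₀ • f + (-s₀) • e with hQ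
    have cP := fun w => contDiff_line hu P w
    have cQ := fun w => contDiff_line hu Q w
    -- the quadratic functions
    have hquad : ∀ α β γ : ℝ, iteratedDeriv 2 (fun τ : ℝ => α + β * τ + γ * τ ^ 2) 0 = 2 * γ := by
      intro α β γ
      rw [iteratedDeriv_succ, iteratedDeriv_one]
      have d1 : deriv (fun τ : ℝ => α + β * τ + γ * τ ^ 2) = fun τ => β + 2 * γ * τ := by
        funext τ
        have := (((hasDerivAt_id τ).const_mul β).const_add α).add
          (((hasDerivAt_id τ).pow 2).const_mul γ)
        refine Eq.trans this.deriv ?_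
        simp; ring
      rw [d1]
      refine Eq.trans (((hasDerivAt_id (0:ℝ)).const_mul (2 * γ)).const_add β).deriv ?_
      simp
    have dneg : iteratedDeriv 2 (fun τ : ℝ => u (Q + (-τ) • e)) 0
        = iteratedDeriv 2 (fun τ : ℝ => u (Q + τ • e)) 0 := by
      have := iteratedDeriv_comp_neg 2 (fun τ : ℝ => u (Q + τ • e)) 0
      simpa using this
    have cQn : ContDiff ℝ 2 (fun τ : ℝ => u (Q + (-τ) • e)) := (cQ e).comp contDiff_neg
    have half : ∀ F G : ℝ → ℝ, ContDiff ℝ 2 F → ContDiff ℝ 2 G →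
        iteratedDeriv 2 (fun τ => 2⁻¹ * (F τ - G τ)) 0
          = 2⁻¹ * (iteratedDeriv 2 F 0 - iteratedDeriv 2 G 0) := by
      intro F G hF hG
      rw [iteratedDeriv_const_mul_field, iteratedDeriv_fun_sub hF.contDiffAt hG.contDiffAt]
    have hA := second_deriv_le (f := fun τ => 2⁻¹ * (u (P + τ • e) - u (Q + (-τ) • e)))
      (k := fun τ => ψ s₀ t₀ + (M / d ^ 2 * (2 * d - 2 * s₀) + N / 2 * (d - 2 * s₀)) * τ
        + (-(M / d ^ 2) - N / 2) * τ ^ 2)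
      (contDiff_const.mul ((cP e).sub cQn)) (by fun_prop) (by
        have : ∀ᶠ τ : ℝ in 𝓝 0, s₀ + τ ∈ Set.Icc 0 d := by
          have hc : ContinuousAt (fun τ : ℝ => s₀ + τ) 0 := by fun_prop
          exact hc.eventually (Icc_mem_nhds (by simpa using h0) (by simpa using h1))
        filter_upwards [this] with τ hτ
        have h := hmax' _ hτ t₀ ⟨ht1, ht2⟩
        have e1 : v (s₀ + τ) t₀ = 2⁻¹ * (u (P + τ • e) - u (Q + (-τ) • e)) := by
          simp only [v, hP, hQ]
          rw [show x + t₀ • f + (s₀ + τ) • e = x + t₀ • f + s₀ • e + τ • e by module,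
            show x + t₀ • f + (-(s₀ + τ)) • e = x + t₀ • f + (-s₀) • e + (-τ) • e by module]
          ring
        have e2 : v s₀ t₀ = 2⁻¹ * (u P - u Q) := by
          simp only [v, hP, hQ]; ring
        rw [e1, e2] at h
        simp only [zero_smul, neg_zero, add_zero, mul_zero, ne_eq, OfNat.ofNat_ne_zero,
          not_false_eq_true, zero_pow]
        refine le_trans (le_of_eq ?_) h
        simp only [ψ]
        ring)
    have hB := second_deriv_le (f := fun τ => 2⁻¹ * (u (P + τ • f) - u (Q + τ • f)))
      (k := fun τ => ψ s₀ t₀ + (M / d ^ 2 * (2 * t₀)) * τ + (M / d ^ 2) * τ ^ 2)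
      (contDiff_const.mul ((cP f).sub (cQ f))) (by fun_prop) (by
        have : ∀ᶠ τ : ℝ in 𝓝 0, t₀ + τ ∈ Set.Icc (-d) d := by
          have hc : ContinuousAt (fun τ : ℝ => t₀ + τ) 0 := by fun_prop
          exact hc.eventually (Icc_mem_nhds (by simpa using h2) (by simpa using h3))
        filter_upwards [this] with τ hτ
        have h := hmax' s₀ ⟨hs1, hs2⟩ _ hτ
        have e1 : v s₀ (t₀ + τ) = 2⁻¹ * (u (P + τ • f) - u (Q + τ • f)) := by
          simp only [v, hP, hQ]
          rw [show x + (t₀ + τ) • f + s₀ • e = x + t₀ • f + s₀ • e + τ • f by module,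
            show x + (t₀ + τ) • f + (-s₀) • e = x + t₀ • f + (-s₀) • e + τ • f by module]
          ring
        have e2 : v s₀ t₀ = 2⁻¹ * (u P - u Q) := by
          simp only [v, hP, hQ]; ring
        rw [e1, e2] at h
        simp only [zero_smul, add_zero, mul_zero, ne_eq, OfNat.ofNat_ne_zero,
          not_false_eq_true, zero_pow]
        refine le_trans (le_of_eq ?_) h
        simp only [ψ]
        ring)
    rw [half _ _ (cP e) cQn, hquad, dneg] at hA
    rw [half _ _ (cP f) (cQ f), hquad] at hB
    have hNP := abs_lt.mp (hN P)
    have hNQ := abs_lt.mp (hN Q)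
    linarith
  -- conclude
  have hdiff : DifferentiableAt ℝ u x := (hu.differentiable (by norm_num)) x
  have hl : HasDerivAt (fun s : ℝ => u (x + s • e)) (fderiv ℝ u x e) 0 := by
    have h1 : HasFDerivAt u (fderiv ℝ u x) (x + (0:ℝ) • e) := by simpa using hdiff.hasFDerivAt
    have h2 : HasDerivAt (fun s : ℝ => x + s • e) e 0 := by
      simpa using ((hasDerivAt_id (0:ℝ)).smul_const e).const_add x
    exact h1.comp_hasDerivAt (0:ℝ) h2
  have hl' : HasDerivAt (fun s : ℝ => u (x + (-s) • e)) (-fderiv ℝ u x e) 0 := by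
    have hl0 : HasDerivAt (fun s : ℝ => u (x + s • e)) (fderiv ℝ u x e) (-0) := by simpa using hl
    have := HasDerivAt.scomp (0:ℝ) hl0 (hasDerivAt_neg (0:ℝ))
    simpa [Function.comp_def] using this
  have hv : HasDerivAt (fun s : ℝ => v s 0) (fderiv ℝ u x e) 0 := by
    have := (hl.sub hl').div_const 2
    have e1 : (fun s : ℝ => v s 0)
        = fun s : ℝ => (u (x + s • e) - u (x + (-s) • e)) / 2 := by
      funext s; simp [v]
    rw [e1]
    exact this.congr_deriv (by ring)
  have htend := hv.tendsto_slope_zero_right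
  refine le_of_tendsto htend ?_
  filter_upwards [Ioc_mem_nhdsGT hd] with s hs
  have h := main s ⟨hs.1.le, hs.2⟩ 0 ⟨by linarith, hd.le⟩
  have hv0 : v 0 0 = 0 := by simp [v]
  simp only [zero_add, hv0, sub_zero, smul_eq_mul]
  rw [inv_mul_le_iff₀ hs.1]
  have h9 : ψ s 0 ≤ s * (2 * M / d + N * d / 2) := by
    have : s * (2 * M / d + N * d / 2) - ψ s 0 = M / d ^ 2 * s ^ 2 + N / 2 * s ^ 2 := by
      simp only [ψ]; field_simp; ring
    have : 0 ≤ M / d ^ 2 * s ^ 2 + N / 2 * s ^ 2 := by positivity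
    linarith
  linarith

lemma grad_norm {u : Pt → ℝ} (hu : ContDiff ℝ 2 u)
    {M N d : ℝ} (hd : 0 < d) (hM : ∀ x, |u x| ≤ M) (hN : ∀ x, |lapR u x| < N) (x : Pt) :
    ‖fderiv ℝ u x‖ ≤ 2 * (2 * M / d + N * d / 2) := by
  have hN0 : 0 < N := (abs_nonneg _).trans_lt (hN 0)
  have hM0 : 0 ≤ M := (abs_nonneg _).trans (hM 0)
  set A := 2 * M / d + N * d / 2 with hA
  have hA0 : 0 ≤ A := by positivity
  set e : Fin 2 → Pt := fun i => EuclideanSpace.single i (1:ℝ) with he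
  have hneg : ∀ (y w : Pt), iteratedDeriv 2 (fun t : ℝ => u (y + t • (-w))) 0
      = iteratedDeriv 2 (fun t : ℝ => u (y + t • w)) 0 := by
    intro y w
    have := iteratedDeriv_comp_neg 2 (fun τ : ℝ => u (y + τ • w)) 0
    simpa using this
  have h01 : ∀ y, |iteratedDeriv 2 (fun t : ℝ => u (y + t • e 0)) 0
      + iteratedDeriv 2 (fun t : ℝ => u (y + t • e 1)) 0| < N := by
    intro y
    have := hN y
    unfold lapR at this
    rwa [Fin.sum_univ_two] at this
  have h10 : ∀ y, |iteratedDeriv 2 (fun t : ℝ => u (y + t • e 1)) 0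
      + iteratedDeriv 2 (fun t : ℝ => u (y + t • e 0)) 0| < N := by
    intro y; rw [add_comm]; exact h01 y
  have a0 := grad_one hu hd hM h01 x
  have a1 := grad_one hu hd hM h10 x
  have b0 := grad_one (e := -e 0) (f := e 1) hu hd hM (by intro y; rw [hneg]; exact h01 y) x
  have b1 := grad_one (e := -e 1) (f := e 0) hu hd hM (by intro y; rw [hneg]; exact h10 y) x
  rw [map_neg] at b0 b1
  have c0 : |fderiv ℝ u x (e 0)| ≤ A := abs_le.mpr ⟨by linarith, a0⟩
  have c1 : |fderiv ℝ u x (e 1)| ≤ A := abs_le.mpr ⟨by linarith, a1⟩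
  refine ContinuousLinearMap.opNorm_le_bound _ (by positivity) fun y => ?_
  have hy : y = y 0 • e 0 + y 1 • e 1 := by
    ext i; fin_cases i <;> simp [he]
  have hyn : ∀ i, |y i| ≤ ‖y‖ := fun i => by
    simpa using PiLp.norm_apply_le y i
  have : fderiv ℝ u x y = y 0 * fderiv ℝ u x (e 0) + y 1 * fderiv ℝ u x (e 1) := by
    conv_lhs => rw [hy]
    simp
  rw [this, Real.norm_eq_abs]
  refine (abs_add_le _ _).trans ?_
  rw [abs_mul, abs_mul]
  have m0 := mul_le_mul (hyn 0) c0 (abs_nonneg _) (norm_nonneg _)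
  have m1 := mul_le_mul (hyn 1) c1 (abs_nonneg _) (norm_nonneg _)
  linarith

lemma grad_single {g ε lam mu κ : ℝ} {u b : Pt → ℝ} (hg : 0 < g) (hε : 0 < ε) (hlam : 0 < lam)
    (hmu : 0 < mu) (hκ : 0 < κ)
    (hu : ContDiff ℝ 2 u) (hb : ∀ x, 0 ≤ b x) (hb' : ∀ x, b x ≤ κ * mu)
    (heq : ∀ x, ε ^ 2 * lapR u x = (‖x‖ ^ 2 + g * u x ^ 2 + b x - lam) * u x)
    (hpos : ∀ x, 0 < u x) (hlim : Tendsto u (cocompact Pt) (𝓝 0)) (x : Pt) :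
    ‖fderiv ℝ u x‖ ≤ (14 + κ) / √g * √lam * (lam + mu + 1) / ε := by
  set M := √lam / √g with hMdef
  have hMp : 0 < M := div_pos (Real.sqrt_pos.mpr hlam) (Real.sqrt_pos.mpr hg)
  have hM2 : M ^ 2 = lam / g := by
    rw [hMdef, div_pow, Real.sq_sqrt hlam.le, Real.sq_sqrt hg.le]
  have hsup := sup_bound hg hε hu hb heq hpos hlim
  have hM : ∀ y, u y ≤ M := fun y =>
    (pow_le_pow_iff_left₀ (hpos y).le hMp.le two_ne_zero).mp (by rw [hM2]; exact hsup y)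
  have hεl := eps_bound hg hε hu hb heq hpos hlim
  have hdec := decay_bound hg hε hlam hu hb heq hpos hlim hM
  set L := lam + mu + 1 with hL
  have hL1 : 1 ≤ L := by linarith
  have hN : ∀ y, |lapR u y| < M * (10 + κ) * L / ε ^ 2 := by
    intro y
    rw [lt_div_iff₀ (by positivity), ← abs_of_pos (show 0 < ε ^ 2 by positivity), ← abs_mul,
      mul_comm, heq]
    have h1 := hdec y
    have h2 : ‖y‖ ^ 2 * u y ≤ 7 * (M * lam) := by nlinarith
    have h3 : 0 ≤ ‖y‖ ^ 2 * u y := mul_nonneg (sq_nonneg _) (hpos y).le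
    have h4 : g * u y ^ 2 ≤ lam := by
      have := hsup y; rw [le_div_iff₀ hg] at this; linarith
    have h5 : g * u y ^ 2 * u y ≤ lam * M := mul_le_mul h4 (hM y) (hpos y).le hlam.le
    have h6 : b y * u y ≤ κ * mu * M := mul_le_mul (hb' y) (hM y) (hpos y).le (by positivity)
    have h7 : lam * u y ≤ lam * M := mul_le_mul_of_nonneg_left (hM y) hlam.le
    have h8 : 0 ≤ g * u y ^ 2 * u y := by have := hpos y; positivity
    have h9 : 0 ≤ b y * u y := mul_nonneg (hb y) (hpos y).le
    have h10 : 0 < lam * u y := mul_pos hlam (hpos y)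
    have e1 : M * (10 + κ) * L = 10 * (M * lam) + 10 * (M * mu) + 10 * M
        + κ * (M * lam) + κ * mu * M + κ * M := by rw [hL]; ring
    have p1 : 0 < M * lam := by positivity
    have p2 : 0 < M * mu := by positivity
    have p3 : 0 < κ * (M * lam) := by positivity
    have p4 : 0 < κ * mu * M := by positivity
    have p5 : 0 < κ * M := by positivity
    rw [abs_lt, e1]
    constructor <;> nlinarith
  have hfin := grad_norm hu (d := ε / L) (by positivity)
    (fun y => by rw [abs_of_pos (hpos y)]; exact hM y) hN x
  refine hfin.trans ?_
  have e1 : (14 + κ) / √g * √lam * L / ε = M * (14 + κ) * L / ε := by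
    rw [hMdef]; ring
  have e2 : 2 * (2 * M / (ε / L) + M * (10 + κ) * L / ε ^ 2 * (ε / L) / 2)
      = (4 * M * L + M * (10 + κ)) / ε := by
    field_simp; ring
  rw [e1, e2]
  gcongr
  have : M * (10 + κ) * 1 ≤ M * (10 + κ) * L := by gcongr
  linarith

/-- A priori `L∞` bounds for positive solutions of the coupled
Gross–Pitaevskii system, with a gradient-bound constant independent of `ε` and
of the coefficients `lam₁, lam₂`. -/
theorem Linfty_bounds_positive_solutions
    (g₁ g₂ g : ℝ) (hg₁ : 0 < g₁) (hg₂ : 0 < g₂) (hg : 0 < g) :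
    ∃ C > 0, ∀ ε lam₁ lam₂ : ℝ, 0 < ε → 0 < lam₁ → 0 < lam₂ →
      ∀ u₁ u₂ : Pt → ℝ, GPPositiveSolution g₁ g₂ g ε lam₁ lam₂ u₁ u₂ →
        (∀ x, u₁ x ^ 2 ≤ lam₁ / g₁) ∧ (∀ x, u₂ x ^ 2 ≤ lam₂ / g₂) ∧
        (∀ x, ‖fderiv ℝ u₁ x‖ ≤ C * Real.sqrt lam₁ * (lam₁ + lam₂ + 1) / ε) ∧
        (∀ x, ‖fderiv ℝ u₂ x‖ ≤ C * Real.sqrt lam₂ * (lam₂ + lam₁ + 1) / ε) := by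
  have k₁ : 0 < (14 + g / g₂) / √g₁ := by positivity
  have k₂ : 0 < (14 + g / g₁) / √g₂ := by positivity
  refine ⟨(14 + g / g₂) / √g₁ + (14 + g / g₁) / √g₂, by positivity, ?_⟩
  intro ε lam₁ lam₂ hε h₁ h₂ u₁ u₂ hsol
  obtain ⟨⟨c₁, c₂, eq₁, eq₂, l₁, l₂⟩, p₁, p₂⟩ := hsol
  have d₁ : ContDiff ℝ 2 u₁ := c₁.of_le (WithTop.coe_le_coe.mpr (le_top : (2 : ℕ∞) ≤ ⊤))
  have d₂ : ContDiff ℝ 2 u₂ := c₂.of_le (WithTop.coe_le_coe.mpr (le_top : (2 : ℕ∞) ≤ ⊤))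
  have E₁ : ∀ x, ε ^ 2 * lapR u₁ x
      = (‖x‖ ^ 2 + g₁ * u₁ x ^ 2 + g * u₂ x ^ 2 - lam₁) * u₁ x := fun x => by
    linarith [eq₁ x]
  have E₂ : ∀ x, ε ^ 2 * lapR u₂ x
      = (‖x‖ ^ 2 + g₂ * u₂ x ^ 2 + g * u₁ x ^ 2 - lam₂) * u₂ x := fun x => by
    linarith [eq₂ x]
  have b₁ : ∀ x, 0 ≤ g * u₂ x ^ 2 := fun x => by positivity
  have b₂ : ∀ x, 0 ≤ g * u₁ x ^ 2 := fun x => by positivity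
  have S₁ := sup_bound hg₁ hε d₁ b₁ E₁ p₁ l₁
  have S₂ := sup_bound hg₂ hε d₂ b₂ E₂ p₂ l₂
  have B₁ : ∀ x, g * u₂ x ^ 2 ≤ g / g₂ * lam₂ := fun x =>
    (mul_le_mul_of_nonneg_left (S₂ x) hg.le).trans (le_of_eq (by ring))
  have B₂ : ∀ x, g * u₁ x ^ 2 ≤ g / g₁ * lam₁ := fun x =>
    (mul_le_mul_of_nonneg_left (S₁ x) hg.le).trans (le_of_eq (by ring))
  refine ⟨S₁, S₂, fun x => ?_, fun x => ?_⟩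
  · refine (grad_single hg₁ hε h₁ h₂ (div_pos hg hg₂) d₁ b₁ B₁ E₁ p₁ l₁ x).trans ?_
    gcongr
    linarith
  · refine (grad_single hg₂ hε h₂ h₁ (div_pos hg hg₁) d₂ b₂ B₂ E₂ p₂ l₂ x).trans ?_
    gcongr
    linarith
end
end

section
/- Let (u₁,u₂) be a positive solution of the coupled Gross–Pitaevskii system with coefficients λ₁,ε, λ₂,ε > 0. For every k > 0 set r_i = √((1+k)λ_{i,ε}) and, for s ≥ r ≥ r_i, W_i(s) = (max_{∂B_r} u_i) · exp( −(1/(2ε)) √(k/(1+k)) (s² − r²) ). Then u_i(x) ≤ W_i(|x|) for all |x| ≥ r ≥ r_i, i = 1,2. Moreover, there exist constants c_ε, C_ε > 0 such that |u_i(x)| + |∇u_i(x)| ≤ C_ε e^{−c_ε|x|²} for all x ∈ ℝ², i = 1,2. -/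
open MeasureTheory Filter
open scoped Real Topology

noncomputable section

lemma d2_nonpos {f : ℝ → ℝ} (h : IsLocalMax f 0) (hc : ContinuousAt f 0) :
    iteratedDeriv 2 f 0 ≤ 0 := by
  by_contra! hpos
  rw [iteratedDeriv_succ, iteratedDeriv_one] at hpos
  have h0 := h.deriv_eq_zero
  have hmin := isLocalMin_of_deriv_deriv_pos hpos h0 hc
  have heq : f =ᶠ[𝓝 0] fun _ => f 0 := by
    filter_upwards [h, hmin] with t h1 h2
    exact le_antisymm h1 h2
  have h3 : deriv (deriv f) 0 = 0 := by
    rw [heq.deriv.deriv_eq]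
    simp
  linarith

lemma lapR_nonpos {f : Pt → ℝ} {x : Pt} (h : IsLocalMax f x) (hc : Continuous f) :
    lapR f x ≤ 0 := by
  unfold lapR
  refine Finset.sum_nonpos fun i _ => ?_
  have hcont : Continuous (fun t : ℝ => x + t • EuclideanSpace.single i (1:ℝ)) := by fun_prop
  apply d2_nonpos
  · have h1 : Tendsto (fun t : ℝ => x + t • EuclideanSpace.single i (1:ℝ)) (𝓝 0) (𝓝 x) := by
      have := hcont.tendsto 0
      simpa using this
    have := h1.eventually h
    unfold IsLocalMax IsMaxFilter
    simpa using this
  · exact (hc.comp hcont).continuousAt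

lemma line_contDiff {f : Pt → ℝ} (hf : ContDiff ℝ (⊤ : ℕ∞) f) (x v : Pt) :
    ContDiff ℝ 2 (fun t : ℝ => f (x + t • v)) := by
  have : ContDiff ℝ 2 f := hf.of_le (by
    rw [show (2 : WithTop ℕ∞) = ((2 : ℕ∞) : WithTop ℕ∞) from rfl]
    exact WithTop.coe_le_coe.2 le_top)
  fun_prop

lemma lapR_sub {f h : Pt → ℝ} (hf : ContDiff ℝ (⊤ : ℕ∞) f) (hh : ContDiff ℝ (⊤ : ℕ∞) h) (x : Pt) :
    lapR (fun y => f y - h y) x = lapR f x - lapR h x := by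
  unfold lapR
  rw [← Finset.sum_sub_distrib]
  refine Finset.sum_congr rfl fun i _ => ?_
  exact iteratedDeriv_fun_sub (line_contDiff hf _ _).contDiffAt (line_contDiff hh _ _).contDiffAt

lemma lapR_const_mul (c : ℝ) (f : Pt → ℝ) (x : Pt) :
    lapR (fun y => c * f y) x = c * lapR f x := by
  unfold lapR
  rw [Finset.mul_sum]
  refine Finset.sum_congr rfl fun i _ => ?_
  exact iteratedDeriv_const_mul_field _ _

lemma lapR_neg (f : Pt → ℝ) (x : Pt) : lapR (fun y => - f y) x = - lapR f x := by
  have := lapR_const_mul (-1) f x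
  simpa using this

lemma lapR_translate (f : Pt → ℝ) (p x : Pt) :
    lapR (fun y => f (p + y)) x = lapR f (p + x) := by
  unfold lapR
  simp only [add_assoc]

/-- reflection of the i-th coordinate -/
def refl2 (i : Fin 2) (y : Pt) : Pt := y - (2 * y i) • EuclideanSpace.single i (1:ℝ)

lemma refl2_contDiff (i : Fin 2) : ContDiff ℝ (⊤ : ℕ∞) (refl2 i) := by
  unfold refl2
  fun_prop

lemma lapR_refl (f : Pt → ℝ) (i : Fin 2) (x : Pt) :
    lapR (fun y => f (refl2 i y)) x = lapR f (refl2 i x) := by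
  unfold lapR
  refine Finset.sum_congr rfl fun k _ => ?_
  by_cases hk : k = i
  · subst hk
    have h1 : (fun t : ℝ => f (refl2 k (x + t • EuclideanSpace.single k (1:ℝ)))) =
        fun t : ℝ => (fun s : ℝ => f (refl2 k x + s • EuclideanSpace.single k (1:ℝ))) (-t) := by
      funext t
      congr 1
      unfold refl2
      simp
      module
    rw [h1, iteratedDeriv_comp_neg 2
      (fun s : ℝ => f (refl2 k x + s • EuclideanSpace.single k (1:ℝ))) 0]
    simp
  · have h1 : (fun t : ℝ => f (refl2 i (x + t • EuclideanSpace.single k (1:ℝ)))) =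
        fun t : ℝ => f (refl2 i x + t • EuclideanSpace.single k (1:ℝ)) := by
      funext t
      congr 1
      unfold refl2
      have : i ≠ k := fun h => hk h.symm
      simp [this]
      module
    rw [h1]

lemma d2_quad (a b c : ℝ) : iteratedDeriv 2 (fun t : ℝ => a + b * t + c * t ^ 2) 0 = 2 * c := by
  rw [iteratedDeriv_succ, iteratedDeriv_one]
  have h1 : deriv (fun t : ℝ => a + b * t + c * t ^ 2) = fun t => b + c * (2 * t) := by
    funext t
    have : HasDerivAt (fun t : ℝ => a + b * t + c * t ^ 2) (0 + b * 1 + c * (2 * t)) t := by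
      have := (((hasDerivAt_const t a).add ((hasDerivAt_id t).const_mul b)).add
        (((hasDerivAt_id t).pow 2).const_mul c))
      refine HasDerivAt.congr_deriv this ?_
      simp
    rw [this.deriv]; ring
  rw [h1]
  have : HasDerivAt (fun t : ℝ => b + c * (2 * t)) (0 + c * (2 * 1)) 0 :=
    (hasDerivAt_const _ b).add (((hasDerivAt_id 0).const_mul 2).const_mul c)
  rw [this.deriv]; ring

lemma d2_gauss (A b d a : ℝ) :
    iteratedDeriv 2 (fun t : ℝ => A * Real.exp (-a * (b + 2 * d * t + t ^ 2))) 0 =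
      A * Real.exp (-a * b) * (4 * a ^ 2 * d ^ 2 - 2 * a) := by
  rw [iteratedDeriv_succ, iteratedDeriv_one]
  have hq : ∀ t : ℝ, HasDerivAt (fun t : ℝ => -a * (b + 2 * d * t + t ^ 2))
      (-a * (2 * d + 2 * t)) t := by
    intro t
    have := (((hasDerivAt_const t b).add ((hasDerivAt_id t).const_mul (2 * d))).add
        ((hasDerivAt_id t).pow 2)).const_mul (-a)
    refine HasDerivAt.congr_deriv this ?_
    simp
  have hE : ∀ t : ℝ, HasDerivAt (fun t : ℝ => A * Real.exp (-a * (b + 2 * d * t + t ^ 2)))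
      (A * (Real.exp (-a * (b + 2 * d * t + t ^ 2)) * (-a * (2 * d + 2 * t)))) t := fun t =>
    ((hq t).exp).const_mul A
  have h1 : deriv (fun t : ℝ => A * Real.exp (-a * (b + 2 * d * t + t ^ 2))) =
      fun t => A * (Real.exp (-a * (b + 2 * d * t + t ^ 2)) * (-a * (2 * d + 2 * t))) :=
    funext fun t => (hE t).deriv
  rw [h1]
  have hl : HasDerivAt (fun t : ℝ => -a * (2 * d + 2 * t)) (-a * (0 + 2 * 1)) 0 :=
    ((hasDerivAt_const _ (2 * d)).add ((hasDerivAt_id 0).const_mul 2)).const_mul (-a)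
  have := (((hq 0).exp).mul hl).const_mul A
  rw [show (fun t => A * (Real.exp (-a * (b + 2 * d * t + t ^ 2)) * (-a * (2 * d + 2 * t)))) =
    (fun y => A * ((fun x => Real.exp (-a * (b + 2 * d * x + x ^ 2))) * fun t => -a * (2 * d + 2 * t)) y)
    from rfl, this.deriv]
  simp
  ring

lemma norm_sq_line (x : Pt) (k : Fin 2) (t : ℝ) :
    ‖x + t • EuclideanSpace.single k (1:ℝ)‖ ^ 2 = ‖x‖ ^ 2 + 2 * x k * t + t ^ 2 := by
  rw [EuclideanSpace.norm_sq_eq, EuclideanSpace.norm_sq_eq]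
  fin_cases k <;> simp [Fin.sum_univ_two] <;> ring

lemma lapR_gauss (A a r : ℝ) (x : Pt) :
    lapR (fun y => A * Real.exp (-a * (‖y‖ ^ 2 - r ^ 2))) x =
      A * Real.exp (-a * (‖x‖ ^ 2 - r ^ 2)) * (4 * a ^ 2 * ‖x‖ ^ 2 - 4 * a) := by
  unfold lapR
  have h : ∀ k : Fin 2, iteratedDeriv 2 (fun t : ℝ => A * Real.exp (-a *
      (‖x + t • EuclideanSpace.single k (1:ℝ)‖ ^ 2 - r ^ 2))) 0 =
      A * Real.exp (-a * (‖x‖ ^ 2 - r ^ 2)) * (4 * a ^ 2 * (x k) ^ 2 - 2 * a) := by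
    intro k
    rw [← d2_gauss]
    congr 1
    funext t
    rw [norm_sq_line]
    congr 3
    ring
  simp only [h]
  rw [EuclideanSpace.norm_sq_eq]
  simp [Fin.sum_univ_two]
  ring

lemma barrier {u V : Pt → ℝ} {ε lam : ℝ} (hε : 0 < ε) (hlam : 0 < lam)
    (hu : ContDiff ℝ (⊤ : ℕ∞) u) (hpos : ∀ x, 0 < u x) (hV : ∀ x, 0 ≤ V x)
    (heq : ∀ x, ε ^ 2 * lapR u x = (‖x‖ ^ 2 - lam + V x) * u x)
    (hlim : Tendsto u (cocompact Pt) (𝓝 0))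
    (k : ℝ) (hk : 0 < k) (r : ℝ) (hr : Real.sqrt ((1 + k) * lam) ≤ r) (x : Pt) (hx : r ≤ ‖x‖) :
    u x ≤ sSup (u '' Metric.sphere (0 : Pt) r) *
            Real.exp (-(1 / (2 * ε)) * Real.sqrt (k / (1 + k)) * (‖x‖ ^ 2 - r ^ 2)) := by
  set A := sSup (u '' Metric.sphere (0 : Pt) r) with hA
  have hkl : 0 < (1 + k) * lam := by positivity
  have hr0 : 0 < r := lt_of_lt_of_le (Real.sqrt_pos.2 hkl) hr
  have hr2 : (1 + k) * lam ≤ r ^ 2 := (Real.sqrt_le_left hr0.le).1 hr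
  have hbdd : BddAbove (u '' Metric.sphere (0 : Pt) r) :=
    ((isCompact_sphere _ _).image hu.continuous).bddAbove
  have hAle : ∀ y : Pt, ‖y‖ = r → u y ≤ A := fun y hy =>
    le_csSup hbdd ⟨y, by simpa using hy, rfl⟩
  have hApos : 0 < A := by
    have h1 : ‖(r • EuclideanSpace.single (0 : Fin 2) (1:ℝ) : Pt)‖ = r := by
      rw [norm_smul]; simp [abs_of_pos hr0]
    exact (hpos _).trans_le (hAle _ h1)
  set a := (1 / (2 * ε)) * Real.sqrt (k / (1 + k)) with ha
  have ha0 : 0 < a := by positivity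
  have ha2 : 4 * a ^ 2 * ε ^ 2 = k / (1 + k) := by
    rw [ha, mul_pow, Real.sq_sqrt (by positivity)]
    field_simp
    norm_num
  rw [neg_mul, ← ha]
  set W : Pt → ℝ := fun y => A * Real.exp (-a * (‖y‖ ^ 2 - r ^ 2)) with hW
  have hWs : ContDiff ℝ (⊤ : ℕ∞) W := by
    have : ContDiff ℝ (⊤ : ℕ∞) (fun y : Pt => ‖y‖ ^ 2) := contDiff_norm_sq ℝ
    fun_prop
  have hWpos : ∀ y, 0 < W y := fun y => by positivity
  by_contra! hcon
  change W x < u x at hcon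
  have hcl : IsClosed {y : Pt | r ≤ ‖y‖} := isClosed_le continuous_const continuous_norm
  have hev : ∀ᶠ y in cocompact Pt ⊓ 𝓟 {y : Pt | r ≤ ‖y‖}, u y - W y ≤ u x - W x := by
    apply Filter.Eventually.filter_mono inf_le_left
    filter_upwards [hlim.eventually (gt_mem_nhds (sub_pos.2 hcon))] with y hy
    linarith [hWpos y]
  obtain ⟨z, hz, hmax⟩ := (hu.continuous.sub hWs.continuous).continuousOn.exists_isMaxOn'
    hcl (x₀ := x) hx hev
  have hzx : u x - W x ≤ u z - W z := hmax hx
  have hzgt : W z < u z := by linarith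
  have hzr : r < ‖z‖ := by
    refine lt_of_le_of_ne hz fun h => ?_
    have h1 := hAle z h.symm
    have h2 : W z = A := by simp [hW, ← h]
    linarith
  have hloc : IsLocalMax (fun y => u y - W y) z := by
    have hop : IsOpen {y : Pt | r < ‖y‖} := isOpen_lt continuous_const continuous_norm
    filter_upwards [hop.mem_nhds hzr] with y hy
    exact hmax (le_of_lt hy : r ≤ ‖y‖)
  have hlap := lapR_nonpos hloc (hu.continuous.sub hWs.continuous)
  rw [lapR_sub hu hWs, hW, lapR_gauss] at hlap
  change lapR u z - W z * _ ≤ 0 at hlap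
  have hz2 : (1 + k) * lam ≤ ‖z‖ ^ 2 := by nlinarith
  have h1 : k / (1 + k) * ‖z‖ ^ 2 ≤ ‖z‖ ^ 2 - lam := by
    rw [div_mul_eq_mul_div, div_le_iff₀ (by positivity)]
    nlinarith
  have h2 : k / (1 + k) * ‖z‖ ^ 2 * u z ≤ ε ^ 2 * lapR u z := by
    rw [heq]
    exact mul_le_mul_of_nonneg_right (by linarith [hV z]) (hpos z).le
  have h3 : ε ^ 2 * (W z * (4 * a ^ 2 * ‖z‖ ^ 2 - 4 * a)) ≤ k / (1 + k) * ‖z‖ ^ 2 * W z := by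
    rw [← ha2]
    have : 0 < ε ^ 2 * (W z * (4 * a)) := by have := hWpos z; positivity
    nlinarith
  have h4 : ε ^ 2 * lapR u z ≤ ε ^ 2 * (W z * (4 * a ^ 2 * ‖z‖ ^ 2 - 4 * a)) :=
    mul_le_mul_of_nonneg_left (by linarith) (by positivity)
  have h5 : k / (1 + k) * ‖z‖ ^ 2 * W z < k / (1 + k) * ‖z‖ ^ 2 * u z :=
    mul_lt_mul_of_pos_left hzgt (by have : 0 < ‖z‖ := hr0.trans hzr; positivity)
  linarith

lemma lapR_pair (f : Pt → ℝ) (x : Pt) {i j : Fin 2} (hij : i ≠ j) :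
    lapR f x = iteratedDeriv 2 (fun t : ℝ => f (x + t • EuclideanSpace.single i (1:ℝ))) 0 +
      iteratedDeriv 2 (fun t : ℝ => f (x + t • EuclideanSpace.single j (1:ℝ))) 0 := by
  unfold lapR
  rw [Fin.sum_univ_two]
  fin_cases i <;> fin_cases j <;> simp at hij ⊢
  ring

lemma lapR_psi (M N : ℝ) {i j : Fin 2} (hij : i ≠ j) (x : Pt) :
    lapR (fun y : Pt => M * (y j ^ 2 + y i * (2 - y i)) + N / 2 * (y i * (1 - y i))) x = - N := by
  rw [lapR_pair _ _ hij]
  have hji := hij.symm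
  have h1 := d2_quad (M * (x j ^ 2 + x i * (2 - x i)) + N / 2 * (x i * (1 - x i)))
    (M * (2 - 2 * x i) + N / 2 * (1 - 2 * x i)) (-M - N / 2)
  have h2 := d2_quad (M * (x j ^ 2 + x i * (2 - x i)) + N / 2 * (x i * (1 - x i)))
    (M * (2 * x j)) M
  rw [show -N = 2 * (-M - N / 2) + 2 * M by ring, ← h1, ← h2]
  congr 2 <;> funext t <;> simp [hij, hji] <;> ring

lemma norm_sq_pair (y : Pt) {i j : Fin 2} (hij : i ≠ j) : ‖y‖ ^ 2 = y i ^ 2 + y j ^ 2 := by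
  rw [EuclideanSpace.norm_sq_eq, Fin.sum_univ_two]
  fin_cases i <;> fin_cases j <;> simp at hij ⊢
  ring

lemma refl2_same (i : Fin 2) (y : Pt) : refl2 i y i = - y i := by
  simp [refl2]; ring

lemma refl2_other {i j : Fin 2} (hij : i ≠ j) (y : Pt) : refl2 i y j = y j := by
  simp [refl2, hij.symm]

lemma grad_phi {u : Pt → ℝ} (hu : ContDiff ℝ (⊤ : ℕ∞) u) {p : Pt} {M N : ℝ} (hM : 0 ≤ M)
    (hN : 0 ≤ N)
    (hb : ∀ y, ‖y‖ ≤ 2 → |u (p + y)| ≤ M) (hl : ∀ y, ‖y‖ ≤ 2 → |lapR u (p + y)| < N)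
    {i j : Fin 2} (hij : i ≠ j) (y : Pt) (hy0 : 0 ≤ y i) (hy1 : y i ≤ 1) (hyj : |y j| ≤ 1) :
    (1 / 2) * (u (p + y) - u (p + refl2 i y)) ≤
      M * (y j ^ 2 + y i * (2 - y i)) + N / 2 * (y i * (1 - y i)) := by
  set S : Set Pt := {y | 0 ≤ y i ∧ y i ≤ 1 ∧ |y j| ≤ 1} with hS
  have hSn : ∀ y ∈ S, ‖y‖ ≤ 2 := by
    rintro y ⟨h0, h1, h2⟩
    have := norm_sq_pair y hij
    have h3 : y j ^ 2 ≤ 1 := by rw [← sq_abs]; nlinarith [abs_nonneg (y j)]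
    nlinarith [norm_nonneg y]
  have hRn : ∀ y ∈ S, ‖refl2 i y‖ ≤ 2 := by
    intro y hy
    have h1 := hSn y hy
    have h2 := norm_sq_pair y hij
    have h3 := norm_sq_pair (refl2 i y) hij
    rw [refl2_same, refl2_other hij] at h3
    have : ‖refl2 i y‖ ^ 2 = ‖y‖ ^ 2 := by rw [h2, h3]; ring
    nlinarith [norm_nonneg y, norm_nonneg (refl2 i y)]
  have hScl : IsClosed S := by
    have c1 : Continuous fun y : Pt => y i := by fun_prop
    have c2 : Continuous fun y : Pt => |y j| := by fun_prop
    exact (isClosed_le continuous_const c1).inter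
      ((isClosed_le c1 continuous_const).inter (isClosed_le c2 continuous_const))
  have hSc : IsCompact S := by
    refine Metric.isCompact_of_isClosed_isBounded hScl ?_
    refine (Metric.isBounded_closedBall (x := (0:Pt)) (r := 2)).subset fun y hy => ?_
    simpa using hSn y hy
  set ψ : Pt → ℝ := fun y => M * (y j ^ 2 + y i * (2 - y i)) + N / 2 * (y i * (1 - y i)) with hψ
  set φ : Pt → ℝ := fun y => (1 / 2) * (u (p + y) - u (p + refl2 i y)) with hφ
  have hψs : ContDiff ℝ (⊤ : ℕ∞) ψ := by fun_prop
  have hu1 : ContDiff ℝ (⊤ : ℕ∞) (fun y => u (p + y)) := by fun_prop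
  have hu2 : ContDiff ℝ (⊤ : ℕ∞) (fun y => u (p + refl2 i y)) := by
    have := refl2_contDiff i
    exact hu1.comp this
  have hφs : ContDiff ℝ (⊤ : ℕ∞) φ := contDiff_const.mul (hu1.sub hu2)
  have hcont := hφs.continuous.sub hψs.continuous
  have hyS : y ∈ S := ⟨hy0, hy1, hyj⟩
  obtain ⟨z, hz, hmax⟩ := hSc.exists_isMaxOn ⟨y, hyS⟩ hcont.continuousOn
  have hzy : φ y - ψ y ≤ φ z - ψ z := hmax hyS
  suffices h : φ z ≤ ψ z by
    change φ y ≤ ψ y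
    linarith
  have hφM : φ z ≤ M := by
    have h1 := (abs_le.1 (hb z (hSn z hz))).2
    have h2 := (abs_le.1 (hb _ (hRn z hz))).1
    simp only [hφ]; linarith
  obtain ⟨hz0, hz1, hzj⟩ := hz
  have hNz : 0 ≤ N / 2 * (z i * (1 - z i)) := by
    have := mul_nonneg hz0 (sub_nonneg.2 hz1); positivity
  rcases hz0.eq_or_lt with h0 | h0
  · have : refl2 i z = z := by simp [refl2, ← h0]
    have h1 : φ z = 0 := by simp [hφ, this]
    have h2 : ψ z = M * z j ^ 2 := by simp [hψ, ← h0]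
    rw [h1, h2]; positivity
  rcases hz1.eq_or_lt with h1 | h1
  · have h2 : ψ z = M * (z j ^ 2 + 1) := by simp [hψ, h1]; left; norm_num
    rw [h2]
    nlinarith [mul_nonneg hM (sq_nonneg (z j))]
  rcases hzj.eq_or_lt with h2 | h2
  · have h3 : z j ^ 2 = 1 := by rw [← sq_abs, h2]; norm_num
    have h4 : 0 ≤ z i * (2 - z i) := mul_nonneg hz0 (by linarith)
    have h5 := mul_nonneg hM h4
    simp only [hψ] 
    rw [h3]
    linarith
  exfalso
  have hloc : IsLocalMax (fun y => φ y - ψ y) z := by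
    have c1 : Continuous fun y : Pt => y i := by fun_prop
    have c2 : Continuous fun y : Pt => |y j| := by fun_prop
    filter_upwards [(isOpen_lt continuous_const c1).mem_nhds h0,
      (isOpen_lt c1 continuous_const).mem_nhds h1,
      (isOpen_lt c2 continuous_const).mem_nhds h2] with w w0 w1 w2
    exact hmax (⟨le_of_lt w0, le_of_lt w1, le_of_lt w2⟩ : w ∈ S)
  have hlap := lapR_nonpos hloc hcont
  have hzS : z ∈ S := ⟨hz0, hz1, hzj⟩
  rw [lapR_sub hφs hψs, hψ, lapR_psi M N hij, hφ, lapR_const_mul, lapR_sub hu1 hu2,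
    lapR_translate, lapR_refl (fun y => u (p + y)), lapR_translate] at hlap
  have h3 := (abs_lt.1 (hl z (hSn z hzS))).1
  have h4 := (abs_lt.1 (hl _ (hRn z hzS))).2
  linarith

lemma grad_dir {u : Pt → ℝ} (hu : ContDiff ℝ (⊤ : ℕ∞) u) {p : Pt} {M N : ℝ} (hM : 0 ≤ M)
    (hN : 0 ≤ N)
    (hb : ∀ y, ‖y‖ ≤ 2 → |u (p + y)| ≤ M) (hl : ∀ y, ‖y‖ ≤ 2 → |lapR u (p + y)| < N)
    (i : Fin 2) :
    fderiv ℝ u p (EuclideanSpace.single i (1:ℝ)) ≤ 2 * M + N / 2 := by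
  obtain ⟨j, hij⟩ : ∃ j : Fin 2, i ≠ j := by
    fin_cases i
    · exact ⟨1, by simp⟩
    · exact ⟨0, by simp⟩
  set e : Pt := EuclideanSpace.single i (1:ℝ) with he
  have hd : DifferentiableAt ℝ u p := (hu.differentiable (by simp)).differentiableAt
  have h1 : HasDerivAt (fun t : ℝ => u (p + t • e)) (fderiv ℝ u p e) 0 := by
    have := hd.hasFDerivAt.hasLineDerivAt e
    exact this
  have h2 : HasDerivAt (fun t : ℝ => u (p + t • (-e))) (fderiv ℝ u p (-e)) 0 := by
    have := hd.hasFDerivAt.hasLineDerivAt (-e)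
    exact this
  have h3 := (h1.sub h2).const_mul (1 / 2 : ℝ)
  have h4 := (h3.hasDerivWithinAt (s := Set.Ioi 0))
  rw [hasDerivWithinAt_iff_tendsto_slope' (by simp)] at h4
  have h5 : (1 / 2 : ℝ) * (fderiv ℝ u p e - fderiv ℝ u p (-e)) = fderiv ℝ u p e := by
    rw [map_neg]; ring
  rw [h5] at h4
  refine le_of_tendsto h4 ?_
  filter_upwards [Ioo_mem_nhdsGT (zero_lt_one' ℝ)] with t ht
  have hti : (t • e : Pt) i = t := by simp [he]
  have htj : (t • e : Pt) j = 0 := by simp [he, hij.symm]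
  have hR : refl2 i (t • e) = t • (-e) := by
    unfold refl2
    rw [hti]
    module
  have h6 := grad_phi hu hM hN hb hl hij (t • e) (by rw [hti]; exact ht.1.le)
    (by rw [hti]; exact ht.2.le) (by rw [htj]; simp)
  rw [hti, htj, hR] at h6
  rw [slope_def_field]
  simp only [Pi.sub_apply]
  rw [div_le_iff₀ (by linarith [ht.1])]
  simp only [zero_smul, sub_self, mul_zero, sub_zero]
  nlinarith [mul_nonneg hM (sq_nonneg t), mul_nonneg hN (sq_nonneg t)]

lemma grad_bound {u : Pt → ℝ} (hu : ContDiff ℝ (⊤ : ℕ∞) u) {p : Pt} {M N : ℝ} (hM : 0 ≤ M)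
    (hN : 0 ≤ N)
    (hb : ∀ y, ‖y‖ ≤ 2 → |u (p + y)| ≤ M) (hl : ∀ y, ‖y‖ ≤ 2 → |lapR u (p + y)| < N) :
    ‖fderiv ℝ u p‖ ≤ 4 * M + N := by
  have habs : ∀ i : Fin 2, |fderiv ℝ u p (EuclideanSpace.single i (1:ℝ))| ≤ 2 * M + N / 2 := by
    intro i
    have h1 := grad_dir hu hM hN hb hl i
    have h2 := grad_dir hu.neg hM hN (p := p) (by simpa using hb)
      (fun y hy => by rw [lapR_neg, abs_neg]; exact hl y hy) i
    rw [fderiv_fun_neg] at h2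
    simp only [neg_apply] at h2
    exact abs_le.2 ⟨by linarith, h1⟩
  refine ContinuousLinearMap.opNorm_le_bound _ (by positivity) fun v => ?_
  have hv : v = v 0 • EuclideanSpace.single (0 : Fin 2) (1:ℝ) + v 1 • EuclideanSpace.single (1 : Fin 2) (1:ℝ) := by
    ext k
    fin_cases k <;> simp
  have hc : ∀ k : Fin 2, |v k| ≤ ‖v‖ := fun k => by
    have := PiLp.norm_apply_le v k
    simpa using this
  have h3 : fderiv ℝ u p v = v 0 * fderiv ℝ u p (EuclideanSpace.single (0 : Fin 2) (1:ℝ)) +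
      v 1 * fderiv ℝ u p (EuclideanSpace.single (1 : Fin 2) (1:ℝ)) := by
    conv_lhs => rw [hv]
    simp
  rw [h3, Real.norm_eq_abs]
  refine (abs_add_le _ _).trans ?_
  rw [abs_mul, abs_mul]
  have h4 := mul_le_mul (hc 0) (habs 0) (abs_nonneg _) (norm_nonneg v)
  have h5 := mul_le_mul (hc 1) (habs 1) (abs_nonneg _) (norm_nonneg v)
  linarith

lemma exists_bound {u : Pt → ℝ} (hu : Continuous u) (hpos : ∀ x, 0 < u x)
    (hlim : Tendsto u (cocompact Pt) (𝓝 0)) : ∃ B > 0, ∀ x, u x ≤ B := by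
  obtain ⟨x, hx⟩ := hu.exists_forall_ge' 0
    ((hlim.eventually (gt_mem_nhds (hpos 0))).mono fun _ h => le_of_lt h)
  exact ⟨u x, hpos x, hx⟩

lemma full_decay {u V : Pt → ℝ} {ε lam K : ℝ} (hε : 0 < ε) (hlam : 0 < lam)
    (hu : ContDiff ℝ (⊤ : ℕ∞) u) (hpos : ∀ x, 0 < u x) (hV : ∀ x, 0 ≤ V x)
    (hVK : ∀ x, V x ≤ K)
    (heq : ∀ x, ε ^ 2 * lapR u x = (‖x‖ ^ 2 - lam + V x) * u x)
    (hlim : Tendsto u (cocompact Pt) (𝓝 0)) :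
    ∃ c > 0, ∃ C > 0, ∀ x : Pt, |u x| + ‖fderiv ℝ u x‖ ≤ C * Real.exp (-c * ‖x‖ ^ 2) := by
  obtain ⟨B, hB, hBu⟩ := exists_bound hu.continuous hpos hlim
  have hK : 0 ≤ K := (hV 0).trans (hVK 0)
  set r := Real.sqrt ((1 + 1) * lam) with hr
  have hr0 : 0 < r := Real.sqrt_pos.2 (by positivity)
  set a := (1 / (2 * ε)) * Real.sqrt (1 / (1 + 1)) with ha
  have ha0 : 0 < a := by positivity
  set A := B * Real.exp (a * r ^ 2) with hA
  have hA0 : 0 < A := by positivity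
  have hdec : ∀ x, u x ≤ A * Real.exp (-a * ‖x‖ ^ 2) := by
    intro x
    have hsplit : A * Real.exp (-a * ‖x‖ ^ 2) = B * Real.exp (-a * (‖x‖ ^ 2 - r ^ 2)) := by
      rw [hA, mul_assoc, ← Real.exp_add]; congr 2; ring
    rw [hsplit]
    rcases le_total r ‖x‖ with h | h
    · have h1 := barrier hε hlam hu hpos hV heq hlim 1 one_pos r le_rfl x h
      rw [neg_mul, ← ha] at h1
      refine h1.trans (mul_le_mul_of_nonneg_right ?_ (Real.exp_pos _).le)
      refine Real.sSup_le ?_ hB.le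
      rintro _ ⟨y, _, rfl⟩
      exact hBu y
    · have h1 : (1:ℝ) ≤ Real.exp (-a * (‖x‖ ^ 2 - r ^ 2)) := by
        apply Real.one_le_exp
        have : ‖x‖ ^ 2 ≤ r ^ 2 := by gcongr
        nlinarith
      nlinarith [hBu x]
  set b := a / 2 with hb
  have hb0 : 0 < b := by positivity
  have hdec' : ∀ x, |u x| ≤ A * Real.exp (-b * ‖x‖ ^ 2) := by
    intro x
    rw [abs_of_pos (hpos x)]
    refine (hdec x).trans ?_
    gcongr
    linarith
  set L := (1 / b + lam + K) * A / ε ^ 2 + 1 with hL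
  have hL0 : 0 < L := by positivity
  have hlap : ∀ x, |lapR u x| < L * Real.exp (-b * ‖x‖ ^ 2) := by
    intro x
    have h0 : |lapR u x| = |‖x‖ ^ 2 - lam + V x| * u x / ε ^ 2 := by
      rw [eq_div_iff (by positivity)]
      have := congrArg abs (heq x)
      rw [abs_mul, abs_mul, abs_of_pos (hpos x), abs_of_pos (by positivity : 0 < ε ^ 2)] at this
      linarith
    have h1 : |‖x‖ ^ 2 - lam + V x| ≤ ‖x‖ ^ 2 + lam + K := by
      have := sq_nonneg ‖x‖
      exact abs_le.2 ⟨by linarith [hV x], by linarith [hVK x]⟩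
    have hE1 : 1 ≤ Real.exp (b * ‖x‖ ^ 2) := Real.one_le_exp (by positivity)
    have hE2 : ‖x‖ ^ 2 ≤ 1 / b * Real.exp (b * ‖x‖ ^ 2) := by
      have := Real.add_one_le_exp (b * ‖x‖ ^ 2)
      rw [one_div, inv_mul_eq_div, le_div_iff₀ hb0]
      linarith
    have h2 : ‖x‖ ^ 2 + lam + K ≤ (1 / b + lam + K) * Real.exp (b * ‖x‖ ^ 2) := by
      nlinarith
    have h3 : |‖x‖ ^ 2 - lam + V x| * u x ≤
        (1 / b + lam + K) * A * Real.exp (-b * ‖x‖ ^ 2) := by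
      have h4 := mul_le_mul (h1.trans h2) (hdec x) (hpos x).le (by positivity)
      refine h4.trans (le_of_eq ?_)
      have : Real.exp (-b * ‖x‖ ^ 2) = Real.exp (b * ‖x‖ ^ 2) * Real.exp (-a * ‖x‖ ^ 2) := by
        rw [← Real.exp_add]; congr 1; rw [hb]; ring
      rw [this]; ring
    rw [h0, hL, add_mul, div_mul_eq_mul_div, one_mul]
    have := Real.exp_pos (-b * ‖x‖ ^ 2)
    have h5 := div_le_div_of_nonneg_right h3 (by positivity : 0 ≤ ε ^ 2)
    linarith
  have hshift : ∀ p y : Pt, ‖y‖ ≤ 2 → Real.exp (-b * ‖p + y‖ ^ 2) ≤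
      Real.exp (4 * b) * Real.exp (-(b / 2) * ‖p‖ ^ 2) := by
    intro p y hy
    rw [← Real.exp_add]
    apply Real.exp_le_exp.2
    have h1 : ‖p‖ ≤ ‖p + y‖ + 2 := by
      have := norm_sub_le (p + y) y
      simp at this
      linarith
    have h2 : ‖p‖ ^ 2 ≤ 2 * ‖p + y‖ ^ 2 + 8 := by
      have : ‖p‖ ^ 2 ≤ (‖p + y‖ + 2) ^ 2 := by gcongr
      nlinarith [sq_nonneg (‖p + y‖ - 2)]
    nlinarith
  refine ⟨b / 2, by positivity, A + 4 * (A * Real.exp (4 * b)) + L * Real.exp (4 * b),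
    by positivity, fun p => ?_⟩
  have hg := grad_bound hu (p := p) (M := A * (Real.exp (4 * b) * Real.exp (-(b / 2) * ‖p‖ ^ 2)))
    (N := L * (Real.exp (4 * b) * Real.exp (-(b / 2) * ‖p‖ ^ 2))) (by positivity) (by positivity)
    (fun y hy => (hdec' _).trans (mul_le_mul_of_nonneg_left (hshift p y hy) hA0.le))
    (fun y hy => (hlap _).trans_le (mul_le_mul_of_nonneg_left (hshift p y hy) hL0.le))
  have h1 : |u p| ≤ A * Real.exp (-(b / 2) * ‖p‖ ^ 2) := by
    refine (hdec' p).trans ?_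
    gcongr
    linarith
  linarith

/-- Gaussian upper barriers for positive solutions and
super-exponential decay of the solutions and their gradients. -/
theorem decay_for_large_x
    (g₁ g₂ g ε lam₁ lam₂ : ℝ)
    (hg₁ : 0 < g₁) (hg₂ : 0 < g₂) (hg : 0 < g) (hε : 0 < ε)
    (hlam₁ : 0 < lam₁) (hlam₂ : 0 < lam₂)
    (u₁ u₂ : Pt → ℝ) (hu : GPPositiveSolution g₁ g₂ g ε lam₁ lam₂ u₁ u₂) :
    (∀ k : ℝ, 0 < k → ∀ r : ℝ, Real.sqrt ((1 + k) * lam₁) ≤ r →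
        ∀ x : Pt, r ≤ ‖x‖ →
          u₁ x ≤ sSup (u₁ '' Metric.sphere (0 : Pt) r) *
            Real.exp (-(1 / (2 * ε)) * Real.sqrt (k / (1 + k)) * (‖x‖ ^ 2 - r ^ 2))) ∧
    (∀ k : ℝ, 0 < k → ∀ r : ℝ, Real.sqrt ((1 + k) * lam₂) ≤ r →
        ∀ x : Pt, r ≤ ‖x‖ →
          u₂ x ≤ sSup (u₂ '' Metric.sphere (0 : Pt) r) *
            Real.exp (-(1 / (2 * ε)) * Real.sqrt (k / (1 + k)) * (‖x‖ ^ 2 - r ^ 2))) ∧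
    (∃ c > 0, ∃ C > 0, ∀ x : Pt,
        |u₁ x| + ‖fderiv ℝ u₁ x‖ ≤ C * Real.exp (-c * ‖x‖ ^ 2) ∧
        |u₂ x| + ‖fderiv ℝ u₂ x‖ ≤ C * Real.exp (-c * ‖x‖ ^ 2)) := by
  obtain ⟨⟨hs₁, hs₂, he₁, he₂, hl₁, hl₂⟩, hp₁, hp₂⟩ := hu
  obtain ⟨B₁, hB₁, hb₁⟩ := exists_bound hs₁.continuous hp₁ hl₁
  obtain ⟨B₂, hB₂, hb₂⟩ := exists_bound hs₂.continuous hp₂ hl₂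
  have hq₁ : ∀ x, u₁ x ^ 2 ≤ B₁ ^ 2 := fun x => pow_le_pow_left₀ (hp₁ x).le (hb₁ x) 2
  have hq₂ : ∀ x, u₂ x ^ 2 ≤ B₂ ^ 2 := fun x => pow_le_pow_left₀ (hp₂ x).le (hb₂ x) 2
  have hV₁ : ∀ x, 0 ≤ g₁ * u₁ x ^ 2 + g * u₂ x ^ 2 := fun x => by positivity
  have hV₂ : ∀ x, 0 ≤ g₂ * u₂ x ^ 2 + g * u₁ x ^ 2 := fun x => by positivity
  have hK₁ : ∀ x, g₁ * u₁ x ^ 2 + g * u₂ x ^ 2 ≤ g₁ * B₁ ^ 2 + g * B₂ ^ 2 := fun x =>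
    add_le_add (mul_le_mul_of_nonneg_left (hq₁ x) hg₁.le)
      (mul_le_mul_of_nonneg_left (hq₂ x) hg.le)
  have hK₂ : ∀ x, g₂ * u₂ x ^ 2 + g * u₁ x ^ 2 ≤ g₂ * B₂ ^ 2 + g * B₁ ^ 2 := fun x =>
    add_le_add (mul_le_mul_of_nonneg_left (hq₂ x) hg₂.le)
      (mul_le_mul_of_nonneg_left (hq₁ x) hg.le)
  have hE₁ : ∀ x, ε ^ 2 * lapR u₁ x =
      (‖x‖ ^ 2 - lam₁ + (g₁ * u₁ x ^ 2 + g * u₂ x ^ 2)) * u₁ x := fun x => by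
    linear_combination -(he₁ x)
  have hE₂ : ∀ x, ε ^ 2 * lapR u₂ x =
      (‖x‖ ^ 2 - lam₂ + (g₂ * u₂ x ^ 2 + g * u₁ x ^ 2)) * u₂ x := fun x => by
    linear_combination -(he₂ x)
  refine ⟨barrier hε hlam₁ hs₁ hp₁ hV₁ hE₁ hl₁, barrier hε hlam₂ hs₂ hp₂ hV₂ hE₂ hl₂, ?_⟩
  obtain ⟨c₁, hc₁, C₁, hC₁, h₁⟩ := full_decay hε hlam₁ hs₁ hp₁ hV₁ hK₁ hE₁ hl₁
  obtain ⟨c₂, hc₂, C₂, hC₂, h₂⟩ := full_decay hε hlam₂ hs₂ hp₂ hV₂ hK₂ hE₂ hl₂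
  refine ⟨min c₁ c₂, lt_min hc₁ hc₂, max C₁ C₂, lt_max_of_lt_left hC₁, fun x => ⟨?_, ?_⟩⟩
  · refine (h₁ x).trans (mul_le_mul (le_max_left _ _) (Real.exp_le_exp.2 ?_)
      (Real.exp_pos _).le (hC₁.le.trans (le_max_left _ _)))
    nlinarith [min_le_left c₁ c₂, sq_nonneg ‖x‖]
  · refine (h₂ x).trans (mul_le_mul (le_max_right _ _) (Real.exp_le_exp.2 ?_)
      (Real.exp_pos _).le (hC₂.le.trans (le_max_right _ _)))
    nlinarith [min_le_right c₁ c₂, sq_nonneg ‖x‖]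
end
end

section
/- Assume the coexistence condition g² < g₁g₂. Given λ₁, λ₂ > 0 and a bounded domain B ⊂ ℝ² with Lipschitz continuous boundary, if (η₁,η₂) and (u₁,u₂) are positive solutions of the elliptic system −ε²Δη₁ + |x|²η₁ + g₁η₁³ + g η₁η₂² = λ₁η₁, −ε²Δη₂ + |x|²η₂ + g₂η₂³ + g η₁²η₂ = λ₂η₂ on the closure of B, such that u_i = η_i on ∂B for i = 1,2, then u_i ≡ η_i in B for i = 1,2. -/
open MeasureTheory Filter
open scoped Real Topology

noncomputable section

lemma aux_T (δ : ℝ) (hδ : 0 < δ) : ∃ T ρ : ℝ → ℝ, (∀ s, HasDerivAt T (ρ s) s) ∧ Continuous ρ ∧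
    (∀ s, 0 ≤ ρ s) ∧ (∀ s, |s| ≤ δ → T s = 0) ∧ (∀ s, |T s - s| ≤ 2 * δ) := by
  obtain ⟨ρ, hρ⟩ : ∃ ρ : ℝ → ℝ, ρ = fun t => min 1 (max 0 (|t| / δ - 1)) := ⟨_, rfl⟩
  have hc : Continuous ρ := by rw [hρ]; fun_prop
  have h0 : ∀ s, 0 ≤ ρ s := by intro s; rw [hρ]; positivity
  have h1 : ∀ s, ρ s ≤ 1 := by intro s; rw [hρ]; exact min_le_left _ _
  have hz : ∀ s, |s| ≤ δ → ρ s = 0 := by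
    intro s hs
    have : |s| / δ ≤ 1 := (div_le_one hδ).2 hs
    simp only [hρ]
    rw [max_eq_left (by linarith)]; simp
  have ho : ∀ s, 2 * δ ≤ |s| → ρ s = 1 := by
    intro s hs
    have : 2 ≤ |s| / δ := (le_div_iff₀ hδ).2 hs
    simp only [hρ]
    rw [max_eq_right (by linarith), min_eq_left (by linarith)]
  have hd : ∀ s, HasDerivAt (fun s => ∫ t in (0:ℝ)..s, ρ t) (ρ s) s := fun s =>
    intervalIntegral.integral_hasDerivAt_right (hc.intervalIntegrable _ _)
      (hc.stronglyMeasurableAtFilter _ _) hc.continuousAt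
  have hD : ∀ s, (∫ t in (0:ℝ)..s, ρ t) - s = ∫ t in (0:ℝ)..s, (ρ t - 1) := by
    intro s
    rw [intervalIntegral.integral_sub (hc.intervalIntegrable _ _) (by simp)]; simp
  have hcs : ∀ a b, IntervalIntegrable (fun t => ρ t - 1) volume a b := fun a b =>
    (hc.sub continuous_const).intervalIntegrable _ _
  have hsm : ∀ s, |s| ≤ 2 * δ → |∫ t in (0:ℝ)..s, (ρ t - 1)| ≤ 2 * δ := by
    intro s hs
    have := intervalIntegral.norm_integral_le_of_norm_le_const (a := 0) (b := s) (C := 1)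
      (f := fun t => ρ t - 1) (fun t _ => by
        rw [Real.norm_eq_abs, abs_le]; constructor <;> linarith [h0 t, h1 t])
    simp only [Real.norm_eq_abs, sub_zero, one_mul] at this
    linarith
  refine ⟨_, ρ, hd, hc, h0, ?_, ?_⟩
  · intro s hs
    refine (intervalIntegral.integral_congr (g := fun _ => (0:ℝ)) ?_).trans (by simp)
    intro t ht
    apply hz
    have := Set.abs_sub_left_of_mem_uIcc ht
    simp at this
    linarith
  · intro s
    rw [hD]
    rcases le_total |s| (2 * δ) with h | h
    · exact hsm s h
    · rcases le_total 0 s with hs | hs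
      · rw [abs_of_nonneg hs] at h
        rw [← intervalIntegral.integral_add_adjacent_intervals (hcs 0 (2*δ)) (hcs _ s),
          intervalIntegral.integral_congr (a := 2 * δ) (g := fun _ => (0:ℝ))]
        · simp only [intervalIntegral.integral_zero, add_zero]
          apply hsm; rw [abs_of_nonneg]; positivity
        · intro t ht
          rw [Set.uIcc_of_le h] at ht
          have := ho t (ht.1.trans (le_abs_self t))
          simp [this]
      · rw [abs_of_nonpos hs] at h
        rw [← intervalIntegral.integral_add_adjacent_intervals (hcs 0 (-(2*δ))) (hcs _ s),
          intervalIntegral.integral_congr (a := -(2 * δ)) (g := fun _ => (0:ℝ))]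
        · simp only [intervalIntegral.integral_zero, add_zero]
          apply hsm; rw [abs_neg, abs_of_nonneg]; positivity
        · intro t ht
          rw [Set.uIcc_of_ge (by linarith)] at ht
          have := ho t (by have := neg_le_abs t; linarith [ht.2])
          simp [this]

lemma aux_ind (B K : Set Pt) (hB : IsOpen B) (hK : IsCompact K) (hKB : K ⊆ B) (f : Pt → ℝ)
    (hf : ContDiffOn ℝ 1 f B) (h0 : ∀ x ∈ B, x ∉ K → f x = 0) :
    ContDiff ℝ 1 (B.indicator f) ∧ HasCompactSupport (B.indicator f) := by
  have hz : ∀ x, x ∉ K → B.indicator f x = 0 := by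
    intro x hx
    by_cases hxB : x ∈ B
    · rw [Set.indicator_of_mem hxB]; exact h0 x hxB hx
    · exact Set.indicator_of_notMem hxB _
  refine ⟨?_, HasCompactSupport.intro hK hz⟩
  rw [contDiff_iff_contDiffAt]
  intro x
  by_cases hx : x ∈ K
  · have hxB := hKB hx
    refine (hf.contDiffAt (hB.mem_nhds hxB)).congr_of_eventuallyEq ?_
    filter_upwards [hB.mem_nhds hxB] with y hy
    exact Set.indicator_of_mem hy _
  · refine (contDiffAt_const (c := (0:ℝ))).congr_of_eventuallyEq ?_
    filter_upwards [hK.isClosed.isOpen_compl.mem_nhds hx] with y hy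
    exact hz y hy

lemma aux_int (G : Pt → ℝ) (v : Pt) (hG : ContDiff ℝ 1 G) (hc : HasCompactSupport G) :
    Integrable (fun x => fderiv ℝ G x v) ∧ ∫ x, fderiv ℝ G x v = 0 := by
  have hcont : Continuous (fun x => fderiv ℝ G x v) :=
    (hG.continuous_fderiv one_ne_zero).clm_apply continuous_const
  have hi : Integrable (fun x => fderiv ℝ G x v) :=
    hcont.integrable_of_hasCompactSupport (hc.fderiv_apply (𝕜 := ℝ) v)
  refine ⟨hi, ?_⟩
  have := integral_bilinear_hasFDerivAt_right_eq_neg_left_of_integrable (μ := (volume : Measure Pt))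
    (f := fun _ : Pt => (1:ℝ)) (f' := fun _ => 0) (g := G) (g' := fderiv ℝ G) (v := v)
    (B := ContinuousLinearMap.mul ℝ ℝ) (by simp) (by simpa using hi)
    (by simpa using hG.continuous.integrable_of_hasCompactSupport hc)
    (fun x _ => hasFDerivAt_const _ _) (fun x _ => (hG.differentiable one_ne_zero x).hasFDerivAt)
  simpa using this

lemma aux_two : (1 : WithTop ℕ∞) + 1 ≤ ((⊤ : ℕ∞) : WithTop ℕ∞) := by
  have h : ((2 : ℕ∞) : WithTop ℕ∞) ≤ ((⊤ : ℕ∞) : WithTop ℕ∞) := WithTop.coe_le_coe.2 le_top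
  rw [one_add_one_eq_two]; exact h

set_option maxHeartbeats 1000000 in
lemma aux_line (B : Set Pt) (hB : IsOpen B) (f : Pt → ℝ) (hf : ContDiffOn ℝ (⊤ : ℕ∞) f B)
    (x : Pt) (hx : x ∈ B) (v : Pt) :
    HasDerivAt (fun t : ℝ => f (x + t • v)) (fderiv ℝ f x v) 0 ∧
    HasDerivAt (fun t : ℝ => fderiv ℝ f (x + t • v) v)
      (iteratedDeriv 2 (fun t : ℝ => f (x + t • v)) 0) 0 := by
  have hl : ∀ t : ℝ, HasDerivAt (fun t : ℝ => x + t • v) v t := by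
    intro t
    simpa using ((hasDerivAt_id t).smul_const v).const_add x
  have h1 : ∀ t : ℝ, x + t • v ∈ B →
      HasDerivAt (fun t : ℝ => f (x + t • v)) (fderiv ℝ f (x + t • v) v) t := by
    intro t ht
    have hd : DifferentiableAt ℝ f (x + t • v) :=
      (hf.contDiffAt (hB.mem_nhds ht)).differentiableAt (by simp)
    exact hd.hasFDerivAt.comp_hasDerivAt t (hl t)
  have hx0 : x + (0:ℝ) • v ∈ B := by simpa using hx
  have hev : ∀ᶠ t : ℝ in 𝓝 0, x + t • v ∈ B :=
    (hl 0).continuousAt.eventually (hB.mem_nhds hx0)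
  refine ⟨by simpa using h1 0 hx0, ?_⟩
  have hdf : DifferentiableAt ℝ (fderiv ℝ f) (x + (0:ℝ) • v) :=
    ((hf.fderiv_of_isOpen hB (m := 1) aux_two).contDiffAt
      (hB.mem_nhds hx0)).differentiableAt (by simp)
  have h2 : DifferentiableAt ℝ (fun t : ℝ => fderiv ℝ f (x + t • v) v) 0 :=
    ((hdf.hasFDerivAt.comp_hasDerivAt (0:ℝ) (hl 0)).clm_apply
      (hasDerivAt_const (0:ℝ) v)).differentiableAt
  have h3 : iteratedDeriv 2 (fun t : ℝ => f (x + t • v)) 0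
      = deriv (fun t : ℝ => fderiv ℝ f (x + t • v) v) 0 := by
    rw [iteratedDeriv_succ, iteratedDeriv_one]
    apply Filter.EventuallyEq.deriv_eq
    filter_upwards [hev] with t ht
    exact (h1 t ht).deriv
  rw [h3]
  exact h2.hasDerivAt

lemma aux_point (B : Set Pt) (hB : IsOpen B) (u η : Pt → ℝ) (hu : ContDiffOn ℝ (⊤ : ℕ∞) u B)
    (hη : ContDiffOn ℝ (⊤ : ℕ∞) η B) (x : Pt) (hx : x ∈ B) (v : Pt) (hup : 0 < u x)
    (hηp : 0 < η x) (T ρ : ℝ → ℝ) (hT : ∀ s, HasDerivAt T (ρ s) s) (hρ : ∀ s, 0 ≤ ρ s)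
    (F : Pt → ℝ) (hF : DifferentiableAt ℝ F x)
    (hFe : ∀ y ∈ B, F y = T (u y / η y - η y / u y) * (η y * fderiv ℝ u y v - u y * fderiv ℝ η y v)) :
    T (u x / η x - η x / u x) *
      (η x * iteratedDeriv 2 (fun t : ℝ => u (x + t • v)) 0 -
        u x * iteratedDeriv 2 (fun t : ℝ => η (x + t • v)) 0) ≤ fderiv ℝ F x v := by
  obtain ⟨u1, u2⟩ := aux_line B hB u hu x hx v
  obtain ⟨e1, e2⟩ := aux_line B hB η hη x hx v
  set U := iteratedDeriv 2 (fun t : ℝ => u (x + t • v)) 0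
  set E := iteratedDeriv 2 (fun t : ℝ => η (x + t • v)) 0
  have hl : HasDerivAt (fun t : ℝ => x + t • v) v 0 := by
    simpa using ((hasDerivAt_id (0:ℝ)).smul_const v).const_add x
  have hx0 : x + (0:ℝ) • v = x := by simp
  have hev : ∀ᶠ t : ℝ in 𝓝 0, x + t • v ∈ B :=
    hl.continuousAt.eventually (hB.mem_nhds (by simpa using hx))
  have hFd : HasDerivAt (fun t : ℝ => F (x + t • v)) (fderiv ℝ F x v) 0 := by
    have h : HasFDerivAt F (fderiv ℝ F x) (x + (0:ℝ) • v) := by rw [hx0]; exact hF.hasFDerivAt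
    exact h.comp_hasDerivAt (0:ℝ) hl
  have hs := (u1.div e1 (by rw [hx0]; exact hηp.ne')).sub (e1.div u1 (by rw [hx0]; exact hup.ne'))
  have hTs := (hT _).comp (0:ℝ) hs
  have hprod := hTs.mul ((e1.mul u2).sub (u1.mul e2))
  have hFd2 := hprod.congr_of_eventuallyEq (f₁ := fun t : ℝ => F (x + t • v)) (by
    filter_upwards [hev] with t ht
    rw [hFe _ ht]; rfl)
  rw [hFd.unique hFd2]
  simp only [Pi.sub_apply, Pi.mul_apply, Pi.div_apply, Function.comp_apply, hx0]
  generalize fderiv ℝ u x v = p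
  generalize fderiv ℝ η x v = q
  generalize hr : ρ (u x / η x - η x / u x) = r
  have hr0 : 0 ≤ r := hr ▸ hρ _
  have key : 0 ≤ r * ((p * η x - u x * q) / η x ^ 2 - (q * u x - η x * p) / u x ^ 2) *
      (η x * p - u x * q) := by
    have : r * ((p * η x - u x * q) / η x ^ 2 - (q * u x - η x * p) / u x ^ 2) *
      (η x * p - u x * q) = r * (η x * p - u x * q)^2 * (1 / η x ^ 2 + 1 / u x ^ 2) := by
      field_simp; ring
    rw [this]; positivity
  nlinarith [key]

lemma aux_main (B : Set Pt) (hB : IsOpen B) (hBb : Bornology.IsBounded B) (u η R : Pt → ℝ)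
    (hu : ContDiffOn ℝ (⊤ : ℕ∞) u (closure B)) (hη : ContDiffOn ℝ (⊤ : ℕ∞) η (closure B))
    (hup : ∀ x ∈ closure B, 0 < u x) (hηp : ∀ x ∈ closure B, 0 < η x)
    (hR : ContinuousOn R (closure B)) (hbd : ∀ x ∈ frontier B, u x = η x)
    (heq : ∀ x ∈ B, η x * lapR u x - u x * lapR η x = u x * η x * R x) :
    ∫ x in B, (u x ^ 2 - η x ^ 2) * R x ≤ 0 := by
  have hcpt : IsCompact (closure B) := hBb.isCompact_closure
  have huc := hu.continuousOn
  have hηc := hη.continuousOn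
  have hu' := hu.mono (subset_closure (s := B))
  have hη' := hη.mono (subset_closure (s := B))
  have hcompInt : ∀ f : Pt → ℝ, ContinuousOn f (closure B) → IntegrableOn f B := fun f hf =>
    (hf.integrableOn_compact hcpt).mono_set subset_closure
  have hfin : volume B < ⊤ := hBb.measure_lt_top
  set s : Pt → ℝ := fun y => u y / η y - η y / u y with hsdef
  have hsc : ContinuousOn s (closure B) :=
    (huc.div hηc fun x hx => (hηp x hx).ne').sub (hηc.div huc fun x hx => (hup x hx).ne')
  obtain ⟨C, hC⟩ := hcpt.exists_bound_of_continuousOn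
    (f := fun x => u x * η x * R x) ((huc.mul hηc).mul hR)
  have step : ∀ δ > 0, ∫ x in B, (u x ^ 2 - η x ^ 2) * R x ≤ δ * (2 * C * volume.real B) := by
    intro δ hδ
    obtain ⟨T, ρ, hT, hρc, hρ, hT0, hTs⟩ := aux_T δ hδ
    have hT1 : ContDiff ℝ 1 T := by
      rw [contDiff_one_iff_deriv]
      refine ⟨fun x => (hT x).differentiableAt, ?_⟩
      rwa [show deriv T = ρ from funext fun x => (hT x).deriv]
    set K := closure B ∩ s ⁻¹' {r | δ ≤ |r|} with hKdef
    have hKc : IsCompact K := by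
      refine hcpt.of_isClosed_subset ?_ Set.inter_subset_left
      exact hsc.preimage_isClosed_of_isClosed isClosed_closure
        (isClosed_le continuous_const continuous_abs)
    have hKB : K ⊆ B := by
      intro x hx
      by_contra hxB
      have hxf : x ∈ frontier B := by
        rw [frontier, hB.interior_eq]; exact ⟨hx.1, hxB⟩
      have h2 : δ ≤ |s x| := hx.2
      have h3 : s x = 0 := by simp [hsdef, hbd x hxf]
      rw [h3] at h2; simp at h2; linarith
    set e : Fin 2 → Pt := fun i => EuclideanSpace.single i (1:ℝ) with hedef
    set f : Fin 2 → Pt → ℝ := fun i y =>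
      T (s y) * (η y * fderiv ℝ u y (e i) - u y * fderiv ℝ η y (e i)) with hfdef
    have hfsm : ∀ i, ContDiffOn ℝ 1 (f i) B := by
      intro i
      have u1 : ContDiffOn ℝ 1 u B := hu'.of_le (by exact_mod_cast le_top)
      have e1 : ContDiffOn ℝ 1 η B := hη'.of_le (by exact_mod_cast le_top)
      have du : ContDiffOn ℝ 1 (fun y => fderiv ℝ u y (e i)) B :=
        (hu'.fderiv_of_isOpen hB (m := 1) aux_two).clm_apply contDiffOn_const
      have de : ContDiffOn ℝ 1 (fun y => fderiv ℝ η y (e i)) B :=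
        (hη'.fderiv_of_isOpen hB (m := 1) aux_two).clm_apply contDiffOn_const
      have hs1 : ContDiffOn ℝ 1 s B :=
        (u1.div e1 fun x hx => (hηp x (subset_closure hx)).ne').sub
          (e1.div u1 fun x hx => (hup x (subset_closure hx)).ne')
      exact (hT1.comp_contDiffOn hs1).mul ((e1.mul du).sub (u1.mul de))
    have hfz : ∀ i, ∀ x ∈ B, x ∉ K → f i x = 0 := by
      intro i x hx hxK
      have : ¬ δ ≤ |s x| := fun h => hxK ⟨subset_closure hx, h⟩
      simp only [hfdef]
      rw [hT0 _ (le_of_not_ge this), zero_mul]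
    have hG := fun i => aux_ind B K hB hKc hKB (f i) (hfsm i) (hfz i)
    have hI := fun i => aux_int (B.indicator (f i)) (e i) (hG i).1 (hG i).2
    have hTc : ContinuousOn (fun x => T (s x)) (closure B) := hT1.continuous.comp_continuousOn hsc
    have hgi : IntegrableOn (fun x => T (s x) * (u x * η x * R x)) B :=
      hcompInt _ (hTc.mul ((huc.mul hηc).mul hR))
    have hle : ∫ x in B, T (s x) * (u x * η x * R x) ≤ 0 := by
      have h0 : ∫ x, ∑ i, fderiv ℝ (B.indicator (f i)) x (e i) = 0 := by
        rw [integral_finsetSum _ (fun i _ => (hI i).1)]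
        simp [(hI _).2]
      rw [← h0, ← integral_indicator hB.measurableSet]
      refine integral_mono (hgi.integrable_indicator hB.measurableSet)
        (integrable_finsetSum _ (fun i _ => (hI i).1)) ?_
      intro x
      by_cases hx : x ∈ B
      · simp only [Set.indicator_of_mem hx]
        rw [← heq x hx]
        have := fun i => aux_point B hB u η hu' hη' x hx (e i) (hup x (subset_closure hx))
          (hηp x (subset_closure hx)) T ρ hT hρ (B.indicator (f i))
          ((hG i).1.differentiable one_ne_zero x)
          (fun y hy => by rw [Set.indicator_of_mem hy])
        refine le_trans (le_of_eq ?_) (Finset.sum_le_sum fun i _ => this i)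
        simp only [lapR, Fin.sum_univ_two, hedef, hsdef]
        ring
      · simp only [Set.indicator_of_notMem hx]
        refine le_of_eq (Finset.sum_eq_zero fun i _ => ?_).symm
        have : B.indicator (f i) =ᶠ[𝓝 x] fun _ => (0:ℝ) := by
          filter_upwards [hKc.isClosed.isOpen_compl.mem_nhds (fun h => hx (hKB h))] with y hy
          by_cases hyB : y ∈ B
          · rw [Set.indicator_of_mem hyB]; exact hfz i y hyB hy
          · exact Set.indicator_of_notMem hyB _
        rw [this.fderiv_eq]; simp
    have hdiff : ‖∫ x in B, ((u x ^ 2 - η x ^ 2) * R x - T (s x) * (u x * η x * R x))‖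
        ≤ (2 * δ * C) * volume.real B := by
      refine norm_setIntegral_le_of_norm_le_const hfin ?_
      intro x hx
      have hx' := subset_closure hx
      have h1 := hup x hx'
      have h2 := hηp x hx'
      have : (u x ^ 2 - η x ^ 2) * R x - T (s x) * (u x * η x * R x)
          = -(T (s x) - s x) * (u x * η x * R x) := by
        have : s x * (u x * η x) = u x ^ 2 - η x ^ 2 := by
          simp only [hsdef]; field_simp
        linear_combination -R x * this
      rw [this, norm_mul, norm_neg]
      exact mul_le_mul (hTs _) (hC x hx') (norm_nonneg _) (by positivity)
    have hpi : IntegrableOn (fun x => (u x ^ 2 - η x ^ 2) * R x) B :=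
      hcompInt _ (((huc.pow 2).sub (hηc.pow 2)).mul hR)
    rw [integral_sub hpi hgi] at hdiff
    have := (le_abs_self _).trans hdiff
    linarith
  by_contra hcon
  push Not at hcon
  set I := ∫ x in B, (u x ^ 2 - η x ^ 2) * R x
  set M := 2 * C * volume.real B
  have h1 := step (I / (2 * (|M| + 1))) (by positivity)
  have h2 : I / (2 * (|M| + 1)) * M ≤ I / 2 := by
    rw [div_mul_eq_mul_div, div_le_div_iff₀ (by positivity) (by norm_num)]
    nlinarith [le_abs_self M]
  linarith

/-- Local uniqueness: two positive solutions of the elliptic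
system on the closure of a bounded (Lipschitz) domain that agree on the
boundary agree everywhere in the domain. -/
theorem local_uniqueness
    (g₁ g₂ g ε lam₁ lam₂ : ℝ)
    (hg₁ : 0 < g₁) (hg₂ : 0 < g₂) (hg : 0 < g) (hε : 0 < ε)
    (hcoex : g ^ 2 < g₁ * g₂) (hlam₁ : 0 < lam₁) (hlam₂ : 0 < lam₂)
    (B : Set Pt) (hBopen : IsOpen B) (hBbdd : Bornology.IsBounded B)
    (η₁ η₂ u₁ u₂ : Pt → ℝ)
    (hηsm₁ : ContDiffOn ℝ (⊤ : ℕ∞) η₁ (closure B))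
    (hηsm₂ : ContDiffOn ℝ (⊤ : ℕ∞) η₂ (closure B))
    (husm₁ : ContDiffOn ℝ (⊤ : ℕ∞) u₁ (closure B))
    (husm₂ : ContDiffOn ℝ (⊤ : ℕ∞) u₂ (closure B))
    (hηpos : ∀ x ∈ closure B, 0 < η₁ x ∧ 0 < η₂ x)
    (hupos : ∀ x ∈ closure B, 0 < u₁ x ∧ 0 < u₂ x)
    (hηeq : ∀ x ∈ closure B,
      -ε ^ 2 * lapR η₁ x + ‖x‖ ^ 2 * η₁ x + g₁ * η₁ x ^ 3
          + g * η₁ x * η₂ x ^ 2 = lam₁ * η₁ x ∧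
      -ε ^ 2 * lapR η₂ x + ‖x‖ ^ 2 * η₂ x + g₂ * η₂ x ^ 3
          + g * η₁ x ^ 2 * η₂ x = lam₂ * η₂ x)
    (hueq : ∀ x ∈ closure B,
      -ε ^ 2 * lapR u₁ x + ‖x‖ ^ 2 * u₁ x + g₁ * u₁ x ^ 3
          + g * u₁ x * u₂ x ^ 2 = lam₁ * u₁ x ∧
      -ε ^ 2 * lapR u₂ x + ‖x‖ ^ 2 * u₂ x + g₂ * u₂ x ^ 3
          + g * u₁ x ^ 2 * u₂ x = lam₂ * u₂ x)
    (hbdry : ∀ x ∈ frontier B, u₁ x = η₁ x ∧ u₂ x = η₂ x) :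
    ∀ x ∈ B, u₁ x = η₁ x ∧ u₂ x = η₂ x := by
  have hηc₁ := hηsm₁.continuousOn
  have hηc₂ := hηsm₂.continuousOn
  have huc₁ := husm₁.continuousOn
  have huc₂ := husm₂.continuousOn
  have hε2 : ε ^ 2 ≠ 0 := by positivity
  have hc1 : ContinuousOn (fun x => (u₁ x ^ 2 - η₁ x ^ 2)) (closure B) := (huc₁.pow 2).sub (hηc₁.pow 2)
  have hc2 : ContinuousOn (fun x => (u₂ x ^ 2 - η₂ x ^ 2)) (closure B) := (huc₂.pow 2).sub (hηc₂.pow 2)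
  have hR1 : ContinuousOn (fun x => (g₁ * (u₁ x ^ 2 - η₁ x ^ 2) + g * (u₂ x ^ 2 - η₂ x ^ 2)) / ε ^ 2)
      (closure B) := ((hc1.const_mul _).add (hc2.const_mul _)).div_const _
  have hR2 : ContinuousOn (fun x => (g₂ * (u₂ x ^ 2 - η₂ x ^ 2) + g * (u₁ x ^ 2 - η₁ x ^ 2)) / ε ^ 2)
      (closure B) := ((hc2.const_mul _).add (hc1.const_mul _)).div_const _
  have m1 := aux_main B hBopen hBbdd u₁ η₁ _ husm₁ hηsm₁ (fun x hx => (hupos x hx).1)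
    (fun x hx => (hηpos x hx).1) hR1 (fun x hx => (hbdry x hx).1) (by
      intro x hx
      have a := (hηeq x (subset_closure hx)).1
      have b := (hueq x (subset_closure hx)).1
      field_simp
      linear_combination u₁ x * a - η₁ x * b)
  have m2 := aux_main B hBopen hBbdd u₂ η₂ _ husm₂ hηsm₂ (fun x hx => (hupos x hx).2)
    (fun x hx => (hηpos x hx).2) hR2 (fun x hx => (hbdry x hx).2) (by
      intro x hx
      have a := (hηeq x (subset_closure hx)).2
      have b := (hueq x (subset_closure hx)).2
      field_simp
      linear_combination u₂ x * a - η₂ x * b)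
  have hcompInt : ∀ f : Pt → ℝ, ContinuousOn f (closure B) → IntegrableOn f B := fun f hf =>
    (hf.integrableOn_compact hBbdd.isCompact_closure).mono_set subset_closure
  have hq : ∀ p q : ℝ, g₁ * (p * (g₁ * p + g * q) + q * (g₂ * q + g * p)) =
      (g₁ * p + g * q) ^ 2 + (g₁ * g₂ - g ^ 2) * q ^ 2 := by intro p q; ring
  have hq0 : ∀ p q : ℝ, 0 ≤ p * (g₁ * p + g * q) + q * (g₂ * q + g * p) := by
    intro p q
    refine nonneg_of_mul_nonneg_right (a := g₁) ?_ hg₁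
    rw [hq]
    have : 0 ≤ g₁ * g₂ - g ^ 2 := by linarith
    positivity
  have hsum := add_nonpos m1 m2
  have hQ1 : ContinuousOn (fun x => (u₁ x ^ 2 - η₁ x ^ 2) *
      ((g₁ * (u₁ x ^ 2 - η₁ x ^ 2) + g * (u₂ x ^ 2 - η₂ x ^ 2)) / ε ^ 2)) (closure B) := hc1.mul hR1
  have hQ2 : ContinuousOn (fun x => (u₂ x ^ 2 - η₂ x ^ 2) *
      ((g₂ * (u₂ x ^ 2 - η₂ x ^ 2) + g * (u₁ x ^ 2 - η₁ x ^ 2)) / ε ^ 2)) (closure B) := hc2.mul hR2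
  rw [← integral_add (hcompInt _ hQ1) (hcompInt _ hQ2)] at hsum
  have hQc := hQ1.add hQ2
  have hQ0 : ∀ x, 0 ≤ (u₁ x ^ 2 - η₁ x ^ 2) *
      ((g₁ * (u₁ x ^ 2 - η₁ x ^ 2) + g * (u₂ x ^ 2 - η₂ x ^ 2)) / ε ^ 2) +
      (u₂ x ^ 2 - η₂ x ^ 2) *
      ((g₂ * (u₂ x ^ 2 - η₂ x ^ 2) + g * (u₁ x ^ 2 - η₁ x ^ 2)) / ε ^ 2) := by
    intro x
    rw [← mul_div_assoc, ← mul_div_assoc, ← add_div]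
    exact div_nonneg (hq0 _ _) (by positivity)
  have hI0 := le_antisymm hsum (integral_nonneg hQ0)
  rw [integral_eq_zero_iff_of_nonneg hQ0 (hcompInt _ hQc)] at hI0
  have hE := Measure.eqOn_open_of_ae_eq hI0 hBopen (hQc.mono subset_closure) continuousOn_const
  intro x hx
  have h0 := hE hx
  have hxc := subset_closure hx
  simp only [Pi.zero_apply] at h0
  rw [← mul_div_assoc, ← mul_div_assoc, ← add_div, div_eq_zero_iff, or_iff_left hε2] at h0
  have h1 := hq (u₁ x ^ 2 - η₁ x ^ 2) (u₂ x ^ 2 - η₂ x ^ 2)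
  rw [h0, mul_zero] at h1
  generalize hp : u₁ x ^ 2 - η₁ x ^ 2 = p at h1
  generalize hq' : u₂ x ^ 2 - η₂ x ^ 2 = q at h1
  have hd : 0 < g₁ * g₂ - g ^ 2 := by linarith
  have hqz : q = 0 := by
    by_contra hne
    have : 0 < (g₁ * g₂ - g ^ 2) * q ^ 2 := by positivity
    nlinarith [sq_nonneg (g₁ * p + g * q)]
  have hpz : p = 0 := by
    rw [hqz] at h1
    by_contra hne
    have : 0 < (g₁ * p) ^ 2 := by positivity
    nlinarith
  rw [hpz] at hp
  rw [hqz] at hq'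
  obtain ⟨a1, a2⟩ := hηpos x hxc
  obtain ⟨b1, b2⟩ := hupos x hxc
  constructor
  · exact (sq_eq_sq₀ b1.le a1.le).1 (by linarith)
  · exact (sq_eq_sq₀ b2.le a2.le).1 (by linarith)
end
end
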